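/- arXiv:1312.0727 — 2 statements merged into one kernel-verified Lean document; each statement's English description precedes it below -/
import Mathlib

section
/- Let n ≥ 1, let 0 < p < q < ∞ with n(1/p − 1/q) = 1, and let g be a holomorphic function on B_n. Then J_g is compact from H^p to H^q (meaning ‖J_g f_k‖_{H^q} → 0 for every sequence (f_k) in H^p with sup_k ‖f_k‖_{H^p} < ∞ converging to 0 uniformly on compact subsets of B_n) if and only if g is constant, in which case J_g ≡ 0. -/
open MeasureTheory Metric Set Filter
open scoped ENNReal NNReal Topology

noncomputable section

/-- ℂⁿ with its Euclidean (Hermitian) structure. -/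
abbrev En (n : ℕ) := EuclideanSpace ℂ (Fin n)

instance (n : ℕ) : MeasurableSpace (En n) := borel _
instance (n : ℕ) : BorelSpace (En n) := ⟨rfl⟩

/-- The open unit ball `B_n` of ℂⁿ. -/
def Bn (n : ℕ) : Set (En n) := Metric.ball 0 1

/-- The unit sphere `S_n = ∂B_n`. -/
def Sn (n : ℕ) : Set (En n) := Metric.sphere 0 1

/-- The Hermitian inner product `⟨z,w⟩ = ∑ z_k * conj (w_k)`. -/
def herm {n : ℕ} (z w : En n) : ℂ := ∑ k, z k * (starRingEnd ℂ) (w k)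

/-- The surface measure on the unit sphere, normalized so that `σ(S_n) = 1`
(the `(2n-1)`-dimensional Hausdorff measure restricted to the sphere, normalized). -/
def sigmaS (n : ℕ) : Measure (En n) :=
  ((μH[(2 * n - 1 : ℝ)] (Sn n))⁻¹) • (μH[(2 * n - 1 : ℝ)]).restrict (Sn n)

/-- Lebesgue measure on the unit ball, normalized so that `v(B_n) = 1`. -/
def volN (n : ℕ) : Measure (En n) :=
  ((volume (Bn n))⁻¹) • volume.restrict (Bn n)

/-- The radial derivative `Rg(z) = ∑ z_k ∂g/∂z_k (z) = (Dg)(z)[z]`. -/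
def radD {n : ℕ} (g : En n → ℂ) (z : En n) : ℂ := fderiv ℂ g z z

/-- The Volterra-type integration operator `J_g f(z) = ∫₀¹ f(tz) Rg(tz) dt/t`. -/
def J {n : ℕ} (g f : En n → ℂ) (z : En n) : ℂ :=
  ∫ t in Set.Ioo (0 : ℝ) 1, f (t • z) * radD g (t • z) / (t : ℂ)

/-- The Hardy space quasinorm `‖f‖_{H^p}`, with values in `ℝ≥0∞`:
`‖f‖_{H^p}^p = sup_{0<r<1} ∫_{S_n} |f(rζ)|^p dσ(ζ)`. -/
def hNorm (n : ℕ) (p : ℝ) (f : En n → ℂ) : ℝ≥0∞ :=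
  (⨆ r ∈ Set.Ioo (0 : ℝ) 1,
    ∫⁻ ζ, (‖f (r • ζ)‖₊ : ℝ≥0∞) ^ p ∂(sigmaS n)) ^ (1 / p)

/-- Membership in the Hardy space `H^p(B_n)`. -/
def MemHp (n : ℕ) (p : ℝ) (f : En n → ℂ) : Prop :=
  DifferentiableOn ℂ f (Bn n) ∧ hNorm n p f < ⊤

/-- The Carleson box `B_δ(ζ) = {z ∈ B_n : |1 - ⟨z,ζ⟩| < δ}`. -/
def cBox {n : ℕ} (ζ : En n) (δ : ℝ) : Set (En n) :=
  {z ∈ Bn n | ‖(1 : ℂ) - herm z ζ‖ < δ}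

/-- The measure `dμ_g(z) = |Rg(z)|²(1-|z|²) dv(z)`. -/
def muJ (n : ℕ) (g : En n → ℂ) : Measure (En n) :=
  (volN n).withDensity
    (fun z => (‖radD g z‖₊ : ℝ≥0∞) ^ 2 * ENNReal.ofReal (1 - ‖z‖ ^ 2))

/-- The admissible approach region `Γ_α(ζ) = {z ∈ B_n : |1-⟨z,ζ⟩| < (α/2)(1-|z|²)}`. -/
def Gam {n : ℕ} (α : ℝ) (ζ : En n) : Set (En n) :=
  {z ∈ Bn n | ‖(1 : ℂ) - herm z ζ‖ < α / 2 * (1 - ‖z‖ ^ 2)}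

open Classical in
/-- The involutive automorphism `φ_a` of the unit ball interchanging `0` and `a`:
`φ_a(z) = (a - P_a z - √(1-|a|²) (z - P_a z)) / (1 - ⟨z,a⟩)`, where `P_a` is the
orthogonal projection onto `ℂa`. -/
def mob {n : ℕ} (a z : En n) : En n :=
  if a = 0 then -z
  else ((1 : ℂ) - herm z a)⁻¹ •
    ((a - (herm z a / herm a a) • a) -
      ((Real.sqrt (1 - ‖a‖ ^ 2) : ℂ)) • (z - (herm z a / herm a a) • a))

/-- The norm of the invariant (real) gradient `∇̃f(z) = ∇(f ∘ φ_z)(0)`. -/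
def invGrad {n : ℕ} {F : Type*} [NormedAddCommGroup F] [NormedSpace ℝ F]
    (f : En n → F) (z : En n) : ℝ :=
  ‖fderiv ℝ (fun w => f (mob z w)) 0‖

/-- The invariant measure `dλ_n(z) = (1-|z|²)^{-(n+1)} dv(z)`. -/
def lamN (n : ℕ) : Measure (En n) :=
  (volN n).withDensity (fun z => ENNReal.ofReal ((1 - ‖z‖ ^ 2) ^ (-(n + 1 : ℝ))))

/-- The invariant Poisson integral `u_φ(z) = ∫_{S_n} φ(ζ) (1-|z|²)ⁿ/|1-⟨z,ζ⟩|^{2n} dσ(ζ)`. -/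
def poisson (n : ℕ) (φ : En n → ℝ) (z : En n) : ℝ :=
  ∫ ζ, φ ζ * ((1 - ‖z‖ ^ 2) ^ n / ‖(1 : ℂ) - herm z ζ‖ ^ (2 * n)) ∂(sigmaS n)

/-- The function `μ̃(ζ) = ∫_{Γ_α(ζ)} (1-|z|²)^{-n} dμ(z)`. -/
def tildeMu (n : ℕ) (α : ℝ) (μ : Measure (En n)) (ζ : En n) : ℝ≥0∞ :=
  ∫⁻ z in Gam α ζ, ENNReal.ofReal ((1 - ‖z‖ ^ 2) ^ (-(n : ℝ))) ∂μ

/-- The `L^{p/(p-s)}(S_n)`-norm of `μ̃`. -/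
def tildeMuNorm (n : ℕ) (α p s : ℝ) (μ : Measure (En n)) : ℝ≥0∞ :=
  (∫⁻ ζ, tildeMu n α μ ζ ^ (p / (p - s)) ∂(sigmaS n)) ^ ((p - s) / p)

/-- The normalization of nonzero vectors is `2`-Lipschitz outside the open unit ball. -/
theorem lipschitzOnWith_inv_norm_smul {E : Type*} [NormedAddCommGroup E] [NormedSpace ℝ E] :
    LipschitzOnWith 2 (fun x : E => ‖x‖⁻¹ • x) {x | 1 ≤ ‖x‖} := by
  refine LipschitzOnWith.of_dist_le_mul fun x hx y hy => ?_
  simp only [mem_ofPred_eq] at hx hy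
  have hx0 : ‖x‖ ≠ 0 := by positivity
  have hy0 : ‖y‖ ≠ 0 := by positivity
  have e1 : ‖x‖⁻¹ • x - ‖y‖⁻¹ • y = ‖x‖⁻¹ • ((x - y) + ((‖y‖ - ‖x‖) * ‖y‖⁻¹) • y) := by
    rw [sub_mul, mul_inv_cancel₀ hy0, sub_smul, one_smul, smul_add, smul_sub, smul_sub, ← mul_smul,
      ← mul_assoc, inv_mul_cancel₀ hx0, one_mul]
    abel
  rw [dist_eq_norm, dist_eq_norm, e1, norm_smul, norm_inv, norm_norm]
  have h2 : ‖(x - y) + ((‖y‖ - ‖x‖) * ‖y‖⁻¹) • y‖ ≤ 2 * ‖x - y‖ := by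
    refine (norm_add_le _ _).trans ?_
    rw [norm_smul, norm_mul, norm_inv, norm_norm, mul_assoc, inv_mul_cancel₀ hy0, mul_one,
      Real.norm_eq_abs]
    have := abs_norm_sub_norm_le y x
    rw [norm_sub_rev y x] at this
    linarith
  calc ‖x‖⁻¹ * ‖(x - y) + ((‖y‖ - ‖x‖) * ‖y‖⁻¹) • y‖ ≤ 1 * (2 * ‖x - y‖) := by
        gcongr
        exact inv_le_one_of_one_le₀ hx
    _ = _ := by simp

section SphereMeasure

variable {E : Type*} [NormedAddCommGroup E] [InnerProductSpace ℝ E] [FiniteDimensional ℝ E]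
  [MeasurableSpace E] [BorelSpace E]

/-- The characteristic function of an isometry-invariant measure is radial. -/
theorem charFun_eq_of_norm_eq {μ : Measure E} (hμ : ∀ e : E ≃ₗᵢ[ℝ] E, μ.map e = μ) {x y : E}
    (hxy : ‖x‖ = ‖y‖) : charFun μ x = charFun μ y := by
  set e := (ℝ ∙ (x - y))ᗮ.reflection with he
  have hex : e x = y := Submodule.reflection_sub hxy
  rw [← hex]
  nth_rw 2 [← hμ e]
  rw [charFun_apply, charFun_apply, integral_map e.continuous.aemeasurable (by fun_prop)]
  simp only [LinearIsometryEquiv.inner_map_map]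

/-- An isometry-invariant probability measure on the unit sphere is unique. -/
theorem eq_of_isometry_invariant_sphere {μ ν : Measure E} [IsProbabilityMeasure μ]
    [IsProbabilityMeasure ν] (hμ : ∀ e : E ≃ₗᵢ[ℝ] E, μ.map e = μ)
    (hν : ∀ e : E ≃ₗᵢ[ℝ] E, ν.map e = ν) (hμS : ∀ᵐ x ∂μ, ‖x‖ = 1) (hνS : ∀ᵐ x ∂ν, ‖x‖ = 1) :
    μ = ν := by
  have key : ∀ (μ ν : Measure E) [IsProbabilityMeasure μ] [IsProbabilityMeasure ν],
      (∀ e : E ≃ₗᵢ[ℝ] E, μ.map e = μ) → (∀ᵐ x ∂ν, ‖x‖ = 1) → ∀ t : E,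
      charFun μ t = ∫ y, ∫ x, Complex.exp (((‖t‖ * inner ℝ x y : ℝ) : ℂ) * Complex.I) ∂μ ∂ν := by
    intro μ ν _ _ hμ hνS t
    have h1 : ∀ᵐ y ∂ν, ∫ x, Complex.exp (((‖t‖ * inner ℝ x y : ℝ) : ℂ) * Complex.I) ∂μ
        = charFun μ t := by
      filter_upwards [hνS] with y hy
      rw [charFun_eq_of_norm_eq hμ (x := t) (y := ‖t‖ • y) (by simp [norm_smul, hy]), charFun_apply]
      simp only [inner_smul_right]
    rw [integral_congr_ae h1]
    simp
  refine Measure.ext_of_charFun (funext fun t => ?_)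
  rw [key μ ν hμ hνS t, key ν μ hν hμS t, integral_integral_swap]
  · simp only [real_inner_comm]
  · refine Integrable.mono' (integrable_const (1 : ℝ)) ?_ ?_
    · refine Continuous.aestronglyMeasurable ?_
      simp only [Function.uncurry_def]
      fun_prop
    · refine Eventually.of_forall fun z => ?_
      simp only [Function.uncurry_def]
      rw [Complex.norm_exp_ofReal_mul_I]

/-- The sphere has finite codimension-one Hausdorff measure. -/
theorem hausdorffMeasure_sphere_lt_top {m : ℕ} (hm : Module.finrank ℝ E = m + 1) :
    (μH[(m : ℝ)] : Measure E) (sphere 0 1) < ⊤ := by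
  have : Fact (Module.finrank ℝ E = m + 1) := ⟨hm⟩
  refine (isCompact_sphere (0 : E) 1).measure_lt_top_of_nhdsWithin fun v hv => ?_
  have hv1 : ‖v‖ = 1 := by simpa using hv
  have hv0 : v ≠ 0 := by rintro rfl; simp at hv1
  set F := (ℝ ∙ v)ᗮ with hF
  have hFd : Module.finrank ℝ F = m := Submodule.finrank_orthogonal_span_singleton hv0
  have hnb : {y : E | 1 / 2 < inner ℝ v y} ∈ 𝓝 v := by
    refine (isOpen_lt continuous_const (by fun_prop)).mem_nhds ?_
    simp [hv1]; norm_num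
  refine ⟨{y : E | 1 / 2 < inner ℝ v y} ∩ sphere 0 1,
    inter_mem (mem_nhdsWithin_of_mem_nhds hnb) self_mem_nhdsWithin, ?_⟩
  have hL : LipschitzOnWith (2 * 1) ((fun x : E => ‖x‖⁻¹ • x) ∘ fun y : F => v + y)
      (closedBall (0 : F) 2) := by
    refine lipschitzOnWith_inv_norm_smul.comp ?_ ?_
    · refine LipschitzOnWith.of_dist_le_mul fun x _ y _ => by simp [Subtype.dist_eq]
    · intro y _
      have hi : inner ℝ v (v + (y : E)) = 1 := by
        rw [inner_add_right, Submodule.mem_orthogonal_singleton_iff_inner_right.1 y.2]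
        simp [hv1]
      have := real_inner_le_norm v (v + (y : E))
      rw [hi, hv1, one_mul] at this
      exact this
  have hfin : (μH[(m : ℝ)] : Measure F) (closedBall (0 : F) 2) < ⊤ := by
    have : ((m : ℝ)) = ((Module.finrank ℝ F : ℕ) : ℝ) := by rw [hFd]
    rw [this]
    exact (isCompact_closedBall (0 : F) 2).measure_lt_top
  have h3 := hL.hausdorffMeasure_image_le (d := (m : ℝ)) (by positivity)
  refine lt_of_le_of_lt (measure_mono ?_) (h3.trans_lt (ENNReal.mul_lt_top ?_ hfin))
  · rintro y ⟨hy, hy1⟩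
    simp only [mem_ofPred_eq] at hy
    have hy1 : ‖y‖ = 1 := by simpa using hy1
    set s : ℝ := inner ℝ v y with hs
    have hs0 : 0 < s := by linarith
    have hmem : s⁻¹ • y - v ∈ F := by
      rw [hF, Submodule.mem_orthogonal_singleton_iff_inner_right, inner_sub_right,
        inner_smul_right, ← hs, inv_mul_cancel₀ hs0.ne']
      simp [hv1]
    refine ⟨⟨_, hmem⟩, ?_, ?_⟩
    · have hs2 : s⁻¹ ≤ 2 := by
        rw [inv_le_comm₀ hs0 (by norm_num)]
        linarith
      have hsq : ‖s⁻¹ • y - v‖ ^ 2 ≤ 2 ^ 2 := by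
        rw [norm_sub_sq_real, inner_smul_left, real_inner_comm, ← hs, norm_smul, hy1, hv1]
        simp only [norm_inv, Real.norm_eq_abs, abs_of_pos hs0]
        simp only [map_inv₀, conj_trivial, mul_one, inv_mul_cancel₀ hs0.ne']
        nlinarith [inv_pos.2 hs0]
      simpa using abs_le_of_sq_le_sq hsq (by norm_num)
    · simp only [Function.comp_apply, add_sub_cancel, norm_smul, hy1, mul_one, norm_inv,
        Real.norm_eq_abs, abs_of_pos hs0, inv_inv, smul_smul, mul_inv_cancel₀ hs0.ne', one_smul]
  · exact ENNReal.rpow_lt_top_of_nonneg (by positivity) (by simp)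

/-- The sphere has positive codimension-one Hausdorff measure. -/
theorem hausdorffMeasure_sphere_pos {m : ℕ} (hm : Module.finrank ℝ E = m + 1) :
    0 < (μH[(m : ℝ)] : Measure E) (sphere 0 1) := by
  have : Fact (Module.finrank ℝ E = m + 1) := ⟨hm⟩
  have : Nontrivial E := Module.nontrivial_of_finrank_pos (R := ℝ) (by omega)
  obtain ⟨v, hv1⟩ := exists_norm_eq E (zero_le_one (α := ℝ))
  have hv0 : v ≠ 0 := by rintro rfl; simp at hv1
  set F := (ℝ ∙ v)ᗮ with hF
  have hFd : Module.finrank ℝ F = m := Submodule.finrank_orthogonal_span_singleton hv0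
  have hpos : 0 < (μH[(m : ℝ)] : Measure F) (ball (0 : F) 1) := by
    have : ((m : ℝ)) = ((Module.finrank ℝ F : ℕ) : ℝ) := by rw [hFd]
    rw [this]
    exact isOpen_ball.measure_pos _ (by simp)
  have h3 := F.lipschitzWith_orthogonalProjectionOnto.hausdorffMeasure_image_le
    (d := (m : ℝ)) (by positivity) (sphere (0 : E) 1)
  simp only [ENNReal.coe_one, ENNReal.one_rpow, one_mul] at h3
  refine lt_of_lt_of_le (hpos.trans_le (measure_mono ?_)) h3
  intro y hy
  have hy1 : ‖(y : E)‖ < 1 := by simpa using hy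
  have hin : inner ℝ v (y : E) = 0 := Submodule.mem_orthogonal_singleton_iff_inner_right.1 y.2
  refine ⟨y + Real.sqrt (1 - ‖(y : E)‖ ^ 2) • v, ?_, ?_⟩
  · have : ‖(y : E) + Real.sqrt (1 - ‖(y : E)‖ ^ 2) • v‖ ^ 2 = 1 := by
      rw [norm_add_sq_real, inner_smul_right, real_inner_comm, hin, norm_smul, hv1]
      simp only [Real.norm_eq_abs, mul_one, sq_abs]
      rw [Real.sq_sqrt (by nlinarith [norm_nonneg (y : E)])]
      ring
    simpa using (pow_eq_one_iff_of_nonneg (norm_nonneg _) (by norm_num)).1 this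
  · rw [map_add, map_smul]
    have : F.orthogonalProjectionOnto v = 0 := by
      rw [Submodule.orthogonalProjectionOnto_eq_zero_iff, hF, Submodule.orthogonal_orthogonal]
      exact Submodule.mem_span_singleton_self v
    simp [this]

end SphereMeasure

theorem map_restrict_sphere_eq {E : Type*} [NormedAddCommGroup E]
    [InnerProductSpace ℝ E] [MeasurableSpace E] [BorelSpace E] {μ : Measure E} (e : E ≃ₗᵢ[ℝ] E)
    (h : μ.map e = μ) :
    (μ.restrict (sphere 0 1)).map e = μ.restrict (sphere 0 1) := by
  have hpre : e ⁻¹' sphere (0 : E) 1 = sphere 0 1 := by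
    ext x; simp
  nth_rw 1 [← hpre]
  rw [← Measure.restrict_map e.continuous.measurable isClosed_sphere.measurableSet, h]

section Polar

open scoped Pointwise

variable {E : Type*} [NormedAddCommGroup E] [InnerProductSpace ℝ E] [FiniteDimensional ℝ E]
  [MeasurableSpace E] [BorelSpace E]

/-- The Lebesgue (full-dimensional Hausdorff) measure on a finite-dimensional real inner
product space. -/
abbrev fullHausdorff (E : Type*) [NormedAddCommGroup E] [InnerProductSpace ℝ E]
    [MeasurableSpace E] [BorelSpace E] : Measure E := μH[((Module.finrank ℝ E : ℕ) : ℝ)]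

/-- The normalized `m`-dimensional Hausdorff measure of the unit sphere. -/
abbrev normalizedSphere (E : Type*) [NormedAddCommGroup E] [InnerProductSpace ℝ E]
    [MeasurableSpace E] [BorelSpace E] (m : ℝ) : Measure E :=
  ((μH[m] : Measure E) (sphere 0 1))⁻¹ • (μH[m] : Measure E).restrict (sphere 0 1)

theorem isProbabilityMeasure_normalizedSphere {m : ℕ} (hm : Module.finrank ℝ E = m + 1) :
    IsProbabilityMeasure (normalizedSphere E m) := by
  constructor
  rw [Measure.smul_apply, Measure.restrict_apply_univ, smul_eq_mul]
  exact ENNReal.inv_mul_cancel (hausdorffMeasure_sphere_pos hm).ne'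
    (hausdorffMeasure_sphere_lt_top hm).ne

/-- Integration in polar coordinates with respect to the normalized Hausdorff measure. -/
theorem exists_lintegral_polar {m : ℕ} (hm : Module.finrank ℝ E = m + 1) :
    ∃ c : ℝ≥0∞, c ≠ 0 ∧ c ≠ ⊤ ∧ ∀ F : E → ℝ≥0∞, Measurable F →
      ∫⁻ z, F z ∂(fullHausdorff E) = c * ∫⁻ r in Ioi (0 : ℝ), ENNReal.ofReal (r ^ m) *
        ∫⁻ ζ, F (r • ζ) ∂(normalizedSphere E m) := by
  have : Nontrivial E := Module.nontrivial_of_finrank_pos (R := ℝ) (by omega)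
  have := isProbabilityMeasure_normalizedSphere (E := E) hm
  set μ := fullHausdorff E with hμ
  have hemb : MeasurableEmbedding ((↑) : sphere (0 : E) 1 → E) :=
    MeasurableEmbedding.subtype_coe isClosed_sphere.measurableSet
  set τ : Measure E := μ.toSphere.map (↑) with hτ
  have hτu : τ univ = μ.toSphere univ := by
    rw [hτ, hemb.map_apply, preimage_univ]
  have hτ0 : τ univ ≠ 0 := by
    rw [hτu, Ne, Measure.measure_univ_eq_zero]
    exact μ.toSphere_ne_zero
  have hτt : τ univ ≠ ⊤ := by
    rw [hτu]; exact measure_ne_top _ _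
  have hinv : ∀ e : E ≃ₗᵢ[ℝ] E, μ.map e = μ := fun e => e.toIsometryEquiv.map_hausdorffMeasure _
  have hτinv : ∀ e : E ≃ₗᵢ[ℝ] E, τ.map e = τ := by
    intro e
    ext s hs
    have hs' : MeasurableSet (e ⁻¹' s) := e.continuous.measurable hs
    rw [Measure.map_apply e.continuous.measurable hs, hτ, hemb.map_apply, hemb.map_apply,
      μ.toSphere_apply' (hemb.measurable hs'), μ.toSphere_apply' (hemb.measurable hs)]
    congr 1
    have hset : Ioo (0 : ℝ) 1 • ((↑) '' ((↑) ⁻¹' (e ⁻¹' s) : Set (sphere (0 : E) 1)) : Set E)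
        = e ⁻¹' (Ioo (0 : ℝ) 1 • ((↑) '' ((↑) ⁻¹' s : Set (sphere (0 : E) 1)))) := by
      ext x
      simp only [Set.mem_smul, Subtype.image_preimage_coe, mem_inter_iff, mem_sphere_zero_iff_norm,
        mem_preimage]
      constructor
      · rintro ⟨r, hr, y, ⟨hy1, hy2⟩, rfl⟩
        exact ⟨r, hr, e y, ⟨by simpa using hy1, hy2⟩, by simp⟩
      · rintro ⟨r, hr, y, ⟨hy1, hy2⟩, hy⟩
        refine ⟨r, hr, e.symm y, ⟨by simpa using hy1, by simpa using hy2⟩, ?_⟩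
        apply e.injective
        simpa using hy
    rw [hset]
    nth_rw 2 [← hinv e]
    exact (e.toHomeomorph.toMeasurableEquiv.map_apply _).symm
  have hprob : IsProbabilityMeasure ((τ univ)⁻¹ • τ) := by
    constructor
    rw [Measure.smul_apply, smul_eq_mul]
    exact ENNReal.inv_mul_cancel hτ0 hτt
  have heq : (τ univ)⁻¹ • τ = normalizedSphere E m := by
    refine eq_of_isometry_invariant_sphere ?_ ?_ ?_ ?_
    · intro e
      rw [Measure.map_smul, hτinv]
    · intro e
      rw [Measure.map_smul, map_restrict_sphere_eq e (e.toIsometryEquiv.map_hausdorffMeasure _)]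
    · refine Measure.ae_smul_measure ?_ _
      rw [hτ, hemb.ae_map_iff]
      exact Eventually.of_forall fun x => by simp
    · refine Measure.ae_smul_measure ?_ _
      refine (ae_restrict_mem isClosed_sphere.measurableSet).mono fun x hx => by simpa using hx
  have hτσ : τ = τ univ • normalizedSphere E m := by
    rw [← heq, smul_smul, ENNReal.mul_inv_cancel hτ0 hτt, one_smul]
  refine ⟨τ univ, hτ0, hτt, fun F hF => ?_⟩
  have h0 : ∫⁻ z, F z ∂μ = ∫⁻ z : ({0}ᶜ : Set E), F z ∂(μ.comap (↑)) := by
    rw [lintegral_subtype_comap (measurableSet_singleton _).compl,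
      restrict_compl_singleton]
  have hmp := μ.measurePreserving_homeomorphUnitSphereProd
  have hFm : Measurable fun x : sphere (0 : E) 1 × Ioi (0 : ℝ) => F ((x.2 : ℝ) • (x.1 : E)) := by
    fun_prop
  have h1 : ∫⁻ z : ({0}ᶜ : Set E), F z ∂(μ.comap (↑)) =
      ∫⁻ x, F ((x.2 : ℝ) • (x.1 : E)) ∂(μ.toSphere.prod (Measure.volumeIoiPow m)) := by
    have hd : m = Module.finrank ℝ E - 1 := by omega
    rw [hd, ← hmp.lintegral_comp hFm]
    refine lintegral_congr fun z => ?_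
    congr 1
    have hz : ‖(z : E)‖ ≠ 0 := norm_ne_zero_iff.2 z.2
    simp [smul_smul, mul_inv_cancel₀ hz]
  rw [h0, h1, lintegral_prod_symm' _ hFm, Measure.volumeIoiPow,
    lintegral_withDensity_eq_lintegral_mul _ (by fun_prop) (by fun_prop)]
  have h2 : ∀ r : ℝ, ∫⁻ x : sphere (0 : E) 1, F (r • (x : E)) ∂μ.toSphere
      = τ univ * ∫⁻ ζ, F (r • ζ) ∂(normalizedSphere E m) := by
    intro r
    rw [← smul_eq_mul, ← lintegral_smul_measure, ← hτσ, hτ, hemb.lintegral_map]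
  simp only [Pi.mul_apply, h2]
  rw [lintegral_subtype_comap measurableSet_Ioi (fun r : ℝ => ENNReal.ofReal (r ^ m) *
    (τ univ * ∫⁻ ζ, F (r • ζ) ∂(normalizedSphere E m))), ← lintegral_const_mul' _ _ hτt]
  refine lintegral_congr fun r => ?_
  ring

end Polar

section Subharmonic

open Real

/-- Subharmonicity of `log ‖h‖` for analytic `h`. -/
theorem log_norm_le_circleAverage {h : ℂ → ℂ} {c : ℂ} {R : ℝ} (hR : R ≠ 0)
    (hh : AnalyticOnNhd ℂ h (closedBall c |R|)) (h0 : h c ≠ 0) :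
    log ‖h c‖ ≤ circleAverage (log ‖h ·‖) c R := by
  rw [hh.circleAverage_log_norm hR h0]
  refine le_add_of_nonneg_left (finsum_nonneg fun u => ?_)
  by_cases hu : u ∈ closedBall c |R|
  · refine mul_nonneg (mod_cast MeromorphicOn.AnalyticOnNhd.divisor_nonneg hh u) ?_
    by_cases huc : u = c
    · simp [huc]
    · rw [← Real.log_abs]
      refine Real.log_nonneg ?_
      have hpos : 0 < ‖c - u‖ := norm_pos_iff.2 (sub_ne_zero.2 (Ne.symm huc))
      rw [abs_mul, abs_inv, abs_norm, ← div_eq_mul_inv, one_le_div hpos]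
      simpa [dist_eq_norm'] using hu
  · simp [hu]

/-- Subharmonicity of `‖h‖ ^ q` for analytic `h` and every `q > 0`. -/
theorem rpow_norm_le_circleAverage {h : ℂ → ℂ} {c : ℂ} {R q : ℝ} (hR : R ≠ 0) (hq : 0 < q)
    (hh : AnalyticOnNhd ℂ h (closedBall c |R|)) :
    ‖h c‖ ^ q ≤ circleAverage (fun z => ‖h z‖ ^ q) c R := by
  by_cases h0 : h c = 0
  · rw [h0, norm_zero, zero_rpow hq.ne']
    exact circleAverage_nonneg_of_nonneg fun z _ => by positivity
  set A := ‖h c‖ with hA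
  have hA0 : 0 < A := norm_pos_iff.2 h0
  have hlog := log_norm_le_circleAverage hR hh h0
  have hsub : sphere c |R| ⊆ closedBall c |R| := sphere_subset_closedBall
  set L : ℂ → ℝ := fun z => if h z = 0 then log A - 1 / q else log ‖h z‖ with hL
  have hcod : (log ‖h ·‖) =ᶠ[codiscreteWithin (sphere c |R|)] L := by
    have h1 := hh.preimage_zero_mem_codiscreteWithin h0 (by simp)
      ((convex_closedBall c |R|).isConnected ⟨c, by simp⟩)
    filter_upwards [codiscreteWithin_mono hsub h1] with z hz
    have : h z ≠ 0 := by simpa using hz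
    simp [hL, this]
  have h_int : CircleIntegrable (log ‖h ·‖) c R :=
    (hh.mono hsub).meromorphicOn.circleIntegrable_log_norm
  have h_intL : CircleIntegrable L c R := h_int.congr_codiscreteWithin hcod
  have hcont : ContinuousOn (fun z => ‖h z‖ ^ q) (sphere c |R|) :=
    ((hh.continuousOn.mono hsub).norm).rpow_const fun z _ => Or.inr hq.le
  have h_intq : CircleIntegrable (fun z => ‖h z‖ ^ q) c R := hcont.circleIntegrable'
  rw [circleAverage_congr_codiscreteWithin hcod hR] at hlog
  have hAq : 0 < A ^ q := rpow_pos_of_pos hA0 q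
  have hle : circleAverage L c R ≤
      circleAverage (fun z => (log A - 1 / q) + (1 / (q * A ^ q)) * ‖h z‖ ^ q) c R := by
    refine circleAverage_mono h_intL ?_ fun z _ => ?_
    · exact (circleIntegrable_const _ _ _).add (h_intq.const_mul _)
    · by_cases hz : h z = 0
      · simp [hL, hz, zero_rpow hq.ne']
      · have hz' : 0 < ‖h z‖ := norm_pos_iff.2 hz
        have h2 : 0 < (‖h z‖ / A) ^ q := by positivity
        have h3 := Real.log_le_sub_one_of_pos h2
        rw [Real.log_rpow (by positivity), Real.log_div hz'.ne' hA0.ne',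
          Real.div_rpow hz'.le hA0.le] at h3
        simp only [hL, hz, if_false]
        have h4 : log ‖h z‖ - log A ≤ (‖h z‖ ^ q / A ^ q - 1) / q := by
          rw [le_div_iff₀ hq]; linarith
        have h5 : (‖h z‖ ^ q / A ^ q - 1) / q = 1 / (q * A ^ q) * ‖h z‖ ^ q - 1 / q := by
          field_simp
        linarith
  have heq : circleAverage (fun z => (log A - 1 / q) + (1 / (q * A ^ q)) * ‖h z‖ ^ q) c R
      = (log A - 1 / q) + (1 / (q * A ^ q)) * circleAverage (fun z => ‖h z‖ ^ q) c R := by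
    have hmul : CircleIntegrable (fun z => (1 / (q * A ^ q)) * ‖h z‖ ^ q) c R := h_intq.const_mul _
    rw [circleAverage_fun_add (circleIntegrable_const _ _ _) hmul,
      circleAverage_const]
    congr 1
    exact circleAverage_fun_smul (a := 1 / (q * A ^ q)) (f := fun z => ‖h z‖ ^ q)
  rw [heq] at hle
  have h6 : 1 / q ≤ 1 / (q * A ^ q) * circleAverage (fun z => ‖h z‖ ^ q) c R := by linarith
  rw [one_div_mul_eq_div, div_le_div_iff₀ hq (by positivity)] at h6
  nlinarith

/-- The sub-mean value property of `‖h‖ ^ q` on the unit circle, for the lower integral. -/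
theorem enorm_rpow_le_lintegral_circle {h : ℂ → ℂ} {q : ℝ} (hq : 0 < q)
    (hh : AnalyticOnNhd ℂ h (closedBall 0 1)) :
    ENNReal.ofReal (2 * π) * ‖h 0‖ₑ ^ q ≤
      ∫⁻ θ in Ioc 0 (2 * π), ‖h (circleMap 0 1 θ)‖ₑ ^ q := by
  have h1 := rpow_norm_le_circleAverage (R := 1) (c := 0) one_ne_zero hq (by simpa using hh)
  have hcont : ContinuousOn (fun z => ‖h z‖ ^ q) (sphere 0 |1|) :=
    ((hh.continuousOn.mono (by simpa using sphere_subset_closedBall)).norm).rpow_const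
      fun z _ => Or.inr hq.le
  have h_int : CircleIntegrable (fun z => ‖h z‖ ^ q) 0 1 := hcont.circleIntegrable'
  rw [circleAverage_def, smul_eq_mul, le_inv_mul_iff₀ (by positivity),
    intervalIntegral.integral_of_le (by positivity)] at h1
  have h2 := ENNReal.ofReal_le_ofReal h1
  have h3 : IntegrableOn (fun θ => ‖h (circleMap 0 1 θ)‖ ^ q) (Ioc 0 (2 * π)) :=
    (intervalIntegrable_iff_integrableOn_Ioc_of_le (by positivity)).1 h_int
  rw [ofReal_integral_eq_lintegral_ofReal h3 (Eventually.of_forall fun θ => by positivity),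
    ENNReal.ofReal_mul (by positivity)] at h2
  simpa only [← ENNReal.ofReal_rpow_of_nonneg (norm_nonneg _) hq.le, ofReal_norm] using h2

end Subharmonic

section Anisotropic

variable {n : ℕ}

theorem finrank_real_En (n : ℕ) : Module.finrank ℝ (En n) = 2 * n := by
  rw [finrank_real_of_complex, finrank_euclideanSpace_fin]

theorem isProbabilityMeasure_sigmaS (hn : 1 ≤ n) : IsProbabilityMeasure (sigmaS n) := by
  have h := isProbabilityMeasure_normalizedSphere (E := En n) (m := 2 * n - 1)
    (by rw [finrank_real_En]; omega)
  have hc : ((2 * n - 1 : ℕ) : ℝ) = 2 * n - 1 := by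
    rw [Nat.cast_sub (by omega)]; push_cast; ring
  rw [hc] at h
  exact h

theorem ae_sigmaS_norm_eq_one (n : ℕ) : ∀ᵐ ζ ∂sigmaS n, ‖ζ‖ = 1 :=
  Measure.ae_smul_measure
    ((ae_restrict_mem isClosed_sphere.measurableSet).mono fun x hx => by simpa using hx) _

theorem exists_lintegral_polar_sigmaS (hn : 1 ≤ n) :
    ∃ c : ℝ≥0∞, c ≠ 0 ∧ c ≠ ⊤ ∧ ∀ F : En n → ℝ≥0∞, Measurable F →
      ∫⁻ z, F z ∂(fullHausdorff (En n)) = c * ∫⁻ r in Ioi (0 : ℝ),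
        ENNReal.ofReal (r ^ (2 * n - 1)) * ∫⁻ ζ, F (r • ζ) ∂(sigmaS n) := by
  have h := exists_lintegral_polar (E := En n) (m := 2 * n - 1)
    (by rw [finrank_real_En]; omega)
  have hc : ((2 * n - 1 : ℕ) : ℝ) = 2 * n - 1 := by
    rw [Nat.cast_sub (by omega)]; push_cast; ring
  rw [hc] at h
  exact h

/-- Integrals over thin shells are controlled by the integral means on spheres. -/
theorem exists_setLIntegral_shell_le (hn : 1 ≤ n) :
    ∃ c : ℝ≥0∞, c ≠ ⊤ ∧ ∀ F : En n → ℝ≥0∞, Measurable F → ∀ ρ : ℝ,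
      ∫⁻ z in {z | ρ ≤ ‖z‖ ∧ ‖z‖ < 1}, F z ∂(fullHausdorff (En n)) ≤
        c * (ENNReal.ofReal (1 - ρ) * ⨆ r ∈ Ioo (0 : ℝ) 1, ∫⁻ ζ, F (r • ζ) ∂(sigmaS n)) := by
  obtain ⟨c, -, hc, h⟩ := exists_lintegral_polar_sigmaS hn
  refine ⟨c, hc, fun F hF ρ => ?_⟩
  have hm : MeasurableSet {z : En n | ρ ≤ ‖z‖ ∧ ‖z‖ < 1} :=
    (measurableSet_le measurable_const measurable_norm).inter
      (measurableSet_lt measurable_norm measurable_const)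
  rw [← lintegral_indicator hm, h _ (hF.indicator hm)]
  gcongr
  set M := ⨆ r ∈ Ioo (0 : ℝ) 1, ∫⁻ ζ, F (r • ζ) ∂(sigmaS n) with hM
  calc ∫⁻ r in Ioi (0 : ℝ), ENNReal.ofReal (r ^ (2 * n - 1)) *
        ∫⁻ ζ, indicator {z : En n | ρ ≤ ‖z‖ ∧ ‖z‖ < 1} F (r • ζ) ∂(sigmaS n)
      ≤ ∫⁻ r in Ioi (0 : ℝ), (Ico ρ 1).indicator (fun _ => M) r := by
        refine setLIntegral_mono' measurableSet_Ioi fun r hr => ?_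
        have hr0 : (0 : ℝ) < r := hr
        have hae : ∀ᵐ ζ ∂sigmaS n, indicator {z : En n | ρ ≤ ‖z‖ ∧ ‖z‖ < 1} F (r • ζ) =
            (Ico ρ 1).indicator (fun r => F (r • ζ)) r := by
          filter_upwards [ae_sigmaS_norm_eq_one n] with ζ hζ
          simp [indicator, norm_smul, hζ, abs_of_pos hr0]
        rw [lintegral_congr_ae hae]
        by_cases hr1 : r ∈ Ico ρ 1
        · simp only [indicator_of_mem hr1]
          refine le_trans (mul_le_of_le_one_left (by positivity) ?_)
            (le_iSup₂_of_le r ⟨hr0, hr1.2⟩ le_rfl)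
          exact ENNReal.ofReal_le_one.2 (pow_le_one₀ hr0.le hr1.2.le)
        · simp [indicator_of_notMem hr1]
    _ ≤ ∫⁻ r, (Ico ρ 1).indicator (fun _ => M) r := setLIntegral_le_lintegral _ _
    _ = ENNReal.ofReal (1 - ρ) * M := by
        rw [lintegral_indicator measurableSet_Ico, setLIntegral_const, Real.volume_Ico, mul_comm]

/-- The measure of a subset of the sphere is controlled by the volume of a thin cone over it. -/
theorem exists_sigmaS_le_cone (hn : 1 ≤ n) :
    ∃ c : ℝ≥0∞, c ≠ ⊤ ∧ ∀ A D : Set (En n), MeasurableSet D → ∀ t : ℝ, 0 < t →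
      t ≤ 1 / 2 → (∀ r : ℝ, 1 - t < r → r < 1 → ∀ ζ ∈ A, ‖ζ‖ = 1 → r • ζ ∈ D) →
      sigmaS n A * ENNReal.ofReal t ≤ c * fullHausdorff (En n) D := by
  obtain ⟨c, hc0, hc, h⟩ := exists_lintegral_polar_sigmaS hn
  refine ⟨c⁻¹ * ENNReal.ofReal (2 ^ (2 * n - 1)), by finiteness, fun A D hD t ht0 ht hAD => ?_⟩
  have h1 := h (D.indicator 1) (measurable_one.indicator hD)
  rw [lintegral_indicator_one hD] at h1
  have h2 : sigmaS n A * ENNReal.ofReal t * ENNReal.ofReal ((1 / 2) ^ (2 * n - 1)) ≤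
      ∫⁻ r in Ioi (0 : ℝ), ENNReal.ofReal (r ^ (2 * n - 1)) *
        ∫⁻ ζ, D.indicator 1 (r • ζ) ∂(sigmaS n) := by
    calc sigmaS n A * ENNReal.ofReal t * ENNReal.ofReal ((1 / 2) ^ (2 * n - 1))
        = ∫⁻ r in Ioo (1 - t) 1, ENNReal.ofReal ((1 / 2) ^ (2 * n - 1)) * sigmaS n A := by
          rw [setLIntegral_const, Real.volume_Ioo]
          ring_nf
      _ ≤ ∫⁻ r in Ioo (1 - t) 1, ENNReal.ofReal (r ^ (2 * n - 1)) *
            ∫⁻ ζ, D.indicator 1 (r • ζ) ∂(sigmaS n) := by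
          refine setLIntegral_mono' measurableSet_Ioo fun r hr => ?_
          gcongr
          · linarith [hr.1]
          · have hm : MeasurableSet ((fun ζ : En n => r • ζ) ⁻¹' D) :=
              (measurable_const_smul r) hD
            have : ∀ ζ : En n, D.indicator (1 : En n → ℝ≥0∞) (r • ζ) =
              ((fun ζ : En n => r • ζ) ⁻¹' D).indicator 1 ζ := fun ζ => rfl
            simp only [this]
            rw [lintegral_indicator_one hm]
            refine measure_mono_ae ?_
            filter_upwards [ae_sigmaS_norm_eq_one n] with ζ hζ hζA
            exact hAD r hr.1 hr.2 ζ hζA hζ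
      _ ≤ _ := lintegral_mono_set fun r hr => by
          simp only [mem_Ioi]; linarith [hr.1]
  calc sigmaS n A * ENNReal.ofReal t
      = (sigmaS n A * ENNReal.ofReal t * ENNReal.ofReal ((1 / 2) ^ (2 * n - 1))) *
          ENNReal.ofReal (2 ^ (2 * n - 1)) := by
        rw [mul_assoc, ← ENNReal.ofReal_mul (by positivity), ← mul_pow]
        norm_num
    _ ≤ (∫⁻ r in Ioi (0 : ℝ), ENNReal.ofReal (r ^ (2 * n - 1)) *
          ∫⁻ ζ, D.indicator 1 (r • ζ) ∂(sigmaS n)) * ENNReal.ofReal (2 ^ (2 * n - 1)) := by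
        gcongr
    _ = c⁻¹ * ENNReal.ofReal (2 ^ (2 * n - 1)) * fullHausdorff (En n) D := by
        rw [h1, mul_right_comm, ← mul_assoc c⁻¹, ENNReal.inv_mul_cancel hc0 hc, one_mul]

/-- The anisotropic dilation scaling by `β * s` along `e` and by `β` orthogonally to `e`. -/
def anisoDilation (e : En n) (β s : ℝ) : En n →ₗ[ℂ] En n :=
  (β : ℂ) • LinearMap.transvection (((s : ℂ) - 1) • (innerSL ℂ e : En n →ₗ[ℂ] ℂ)) e

theorem anisoDilation_apply (e : En n) (β s : ℝ) (z : En n) :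
    anisoDilation e β s z = (β : ℂ) • (z + (((s : ℂ) - 1) * inner ℂ e z) • e) := by
  simp [anisoDilation, LinearMap.transvection.apply]

theorem det_anisoDilation {e : En n} (he : ‖e‖ = 1) (β s : ℝ) :
    LinearMap.det ((anisoDilation e β s).restrictScalars ℝ) = (β ^ 2) ^ n * s ^ 2 := by
  rw [LinearMap.det_restrictScalars, anisoDilation, LinearMap.det_smul,
    LinearMap.transvection.det, Algebra.norm_complex_eq, finrank_euclideanSpace_fin]
  simp [he, Complex.normSq_eq_norm_sq]
  rw [mul_pow, ← pow_mul, mul_comm n 2, pow_mul, sq_abs, sq_abs]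

theorem norm_sq_add_smul_inner {e : En n} (he : ‖e‖ = 1) (k : ℝ) (z : En n) :
    ‖z + (((k : ℂ) - 1) * inner ℂ e z) • e‖ ^ 2 =
      ‖z‖ ^ 2 + (k ^ 2 - 1) * ‖(inner ℂ e z : ℂ)‖ ^ 2 := by
  rw [norm_add_sq (𝕜 := ℂ), inner_smul_right, norm_smul, he, norm_mul]
  have h1 : (inner ℂ z e : ℂ) = (starRingEnd ℂ) (inner ℂ e z) := (inner_conj_symm z e).symm
  have h2 : (((k : ℂ) - 1) * inner ℂ e z) * (inner ℂ z e : ℂ) =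
      (((k - 1) * ‖(inner ℂ e z : ℂ)‖ ^ 2 : ℝ) : ℂ) := by
    rw [h1, mul_assoc, Complex.mul_conj, Complex.normSq_eq_norm_sq]
    push_cast; ring
  have h3 : ‖(k : ℂ) - 1‖ ^ 2 = (k - 1) ^ 2 := by
    have : (k : ℂ) - 1 = ((k - 1 : ℝ) : ℂ) := by push_cast; ring
    rw [this, Complex.norm_real, Real.norm_eq_abs, sq_abs]
  rw [h2, mul_one, mul_pow, h3]
  simp only [RCLike.re_to_complex, Complex.ofReal_re]
  ring

end Anisotropic

section Caps

variable {n : ℕ}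

theorem fullHausdorff_image_anisoDilation {e : En n} (he : ‖e‖ = 1) (β s : ℝ) (w : En n)
    (S : Set (En n)) :
    fullHausdorff (En n) ((fun v => w + anisoDilation e β s v) '' S) =
      ENNReal.ofReal ((β ^ 2) ^ n * s ^ 2) * fullHausdorff (En n) S := by
  have h := Measure.addHaar_image_linearMap (fullHausdorff (En n))
    ((anisoDilation e β s).restrictScalars ℝ) S
  rw [det_anisoDilation he, abs_of_nonneg (by positivity)] at h
  rw [← h, ← image_image (fun v => w + v), image_add_left, measure_preimage_add]
  rfl

theorem subset_image_anisoDilation {e : En n} (he : ‖e‖ = 1) {t : ℝ} (ht : 0 < t) :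
    {z : En n | ‖z‖ < 1 ∧ ‖1 - inner ℂ e z‖ < 2 * t} ⊆
      (fun v => e + anisoDilation e √t √t v) '' ball 0 3 := by
  rintro z ⟨hz, hz'⟩
  have hs : 0 < √t := Real.sqrt_pos.2 ht
  have hsq : √t ^ 2 = t := Real.sq_sqrt ht.le
  have hee : (inner ℂ e e : ℂ) = 1 := by rw [inner_self_eq_norm_sq_to_K, he]; simp
  set u := z - e with hu
  have hiu : (inner ℂ e u : ℂ) = inner ℂ e z - 1 := by rw [hu, inner_sub_right, hee]
  have hnu : ‖(inner ℂ e u : ℂ)‖ < 2 * t := by rwa [hiu, ← norm_neg, neg_sub]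
  have hu2 : ‖u‖ ^ 2 ≤ 4 * t := by
    have h1 := norm_sub_sq (𝕜 := ℂ) z e
    have h2 : RCLike.re (inner ℂ z e) = (inner ℂ e z : ℂ).re := by
      rw [← inner_conj_symm]; exact Complex.conj_re _
    have h3 : (1 - inner ℂ e z : ℂ).re ≤ ‖(1 - inner ℂ e z : ℂ)‖ := Complex.re_le_norm _
    rw [h2, he] at h1
    simp only [Complex.sub_re, Complex.one_re] at h3
    rw [hu, h1]
    nlinarith [norm_nonneg z]
  have hs' : ((√t : ℝ) : ℂ) ≠ 0 := mod_cast hs.ne'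
  refine ⟨((√t : ℂ)⁻¹) • (u + (((((√t)⁻¹ : ℝ) : ℂ) - 1) * inner ℂ e u) • e), ?_, ?_⟩
  · rw [mem_ball_zero_iff]
    refine lt_of_pow_lt_pow_left₀ 2 (by norm_num) ?_
    rw [norm_smul, mul_pow, norm_sq_add_smul_inner he, norm_inv, Complex.norm_real,
      Real.norm_of_nonneg hs.le, inv_pow, hsq]
    have h4 : ‖(inner ℂ e u : ℂ)‖ ^ 2 ≤ 4 * t ^ 2 := by
      nlinarith [norm_nonneg (inner ℂ e u : ℂ)]
    have h5 : (t⁻¹ - 1) * ‖(inner ℂ e u : ℂ)‖ ^ 2 ≤ 4 * t := by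
      have : t⁻¹ * ‖(inner ℂ e u : ℂ)‖ ^ 2 ≤ t⁻¹ * (4 * t ^ 2) := by gcongr
      have h6 : t⁻¹ * (4 * t ^ 2) = 4 * t := by field_simp
      nlinarith [sq_nonneg ‖(inner ℂ e u : ℂ)‖]
    calc t⁻¹ * (‖u‖ ^ 2 + (t⁻¹ - 1) * ‖(inner ℂ e u : ℂ)‖ ^ 2) ≤ t⁻¹ * (4 * t + 4 * t) := by
          gcongr
      _ = 8 := by field_simp; norm_num
      _ < 3 ^ 2 := by norm_num
  · simp only [anisoDilation_apply, inner_smul_right, inner_add_right, hee, Complex.ofReal_inv]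
    have : z = e + u := by rw [hu]; abel
    rw [this]
    congr 1
    simp only [smul_add, smul_smul]
    match_scalars
    · field_simp
    · field_simp
      ring

/-- The normalized surface measure of a nonisotropic cap. -/
theorem exists_sigmaS_cap_le (hn : 1 ≤ n) :
    ∃ C : ℝ≥0∞, C ≠ ⊤ ∧ ∀ e : En n, ‖e‖ = 1 → ∀ t : ℝ, 0 < t →
      sigmaS n {ζ | ‖1 - inner ℂ e ζ‖ < t} ≤ C * ENNReal.ofReal (t ^ n) := by
  obtain ⟨c, hc, h⟩ := exists_sigmaS_le_cone hn
  have := isProbabilityMeasure_sigmaS hn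
  have hV : fullHausdorff (En n) (ball 0 3) ≠ ⊤ := measure_ball_lt_top.ne
  refine ⟨c * fullHausdorff (En n) (ball 0 3) + ENNReal.ofReal (2 ^ n), by finiteness,
    fun e he t ht => ?_⟩
  rcases le_or_gt t (1 / 2) with ht2 | ht2
  · refine le_trans ?_ (mul_le_mul_left (le_self_add : _ ≤ _ + ENNReal.ofReal (2 ^ n)) _)
    have hD : MeasurableSet {z : En n | ‖z‖ < 1 ∧ ‖1 - inner ℂ e z‖ < 2 * t} := by
      refine (IsOpen.inter ?_ ?_).measurableSet
      · exact isOpen_lt continuous_norm continuous_const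
      · exact isOpen_lt (continuous_const.sub (innerSL ℂ e).continuous).norm continuous_const
    have h1 := h {ζ | ‖1 - inner ℂ e ζ‖ < t} _ hD t ht ht2 fun r hr hr1 ζ hζ hζ1 => by
      have hr0 : 0 < r := by linarith
      refine ⟨by rw [norm_smul, hζ1, Real.norm_of_nonneg hr0.le]; linarith, ?_⟩
      have h2 : (1 - inner ℂ e (r • ζ) : ℂ) =
          (1 - inner ℂ e ζ) + ((1 - r : ℝ) : ℂ) * inner ℂ e ζ := by
        rw [← Complex.coe_smul, inner_smul_right]; push_cast; ring
      have h3 : ‖(inner ℂ e ζ : ℂ)‖ ≤ 1 := by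
        simpa [he, hζ1] using norm_inner_le_norm (𝕜 := ℂ) e ζ
      rw [h2]
      refine (norm_add_le _ _).trans_lt ?_
      rw [norm_mul, Complex.norm_real, Real.norm_of_nonneg (by linarith)]
      have : ‖(1 - inner ℂ e ζ : ℂ)‖ < t := hζ
      nlinarith
    have h4 := measure_mono (μ := fullHausdorff (En n)) (subset_image_anisoDilation he ht)
    rw [fullHausdorff_image_anisoDilation he, Real.sq_sqrt ht.le,
      ENNReal.ofReal_mul (by positivity)] at h4
    have h5 := h1.trans (mul_le_mul_right h4 c)
    have h6 : c * (ENNReal.ofReal (t ^ n) * ENNReal.ofReal t * fullHausdorff (En n) (ball 0 3)) =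
        c * fullHausdorff (En n) (ball 0 3) * ENNReal.ofReal (t ^ n) * ENNReal.ofReal t := by ring
    rw [h6] at h5
    exact (ENNReal.mul_le_mul_iff_left (by simpa using ht) ENNReal.ofReal_ne_top).1 h5
  · refine prob_le_one.trans (le_trans ?_ (mul_le_mul_left le_add_self _))
    rw [← ENNReal.ofReal_mul (by positivity), ← mul_pow, ENNReal.one_le_ofReal]
    exact one_le_pow₀ (by linarith)

end Caps

section TestFunctions

variable {n : ℕ}

theorem exists_unit_smul_eq (hn : 1 ≤ n) (b : En n) : ∃ e : En n, ‖e‖ = 1 ∧ b = ‖b‖ • e := by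
  by_cases hb : b = 0
  · exact ⟨EuclideanSpace.single ⟨0, hn⟩ 1, by simp, by simp [hb]⟩
  · have hb' : ‖b‖ ≠ 0 := norm_ne_zero_iff.2 hb
    refine ⟨‖b‖⁻¹ • b, ?_, ?_⟩
    · rw [norm_smul, norm_inv, norm_norm, inv_mul_cancel₀ hb']
    · rw [smul_smul, mul_inv_cancel₀ hb', one_smul]

theorem inner_real_smul_left (e z : En n) (r : ℝ) :
    (inner ℂ (r • e) z : ℂ) = r * inner ℂ e z := by
  rw [← Complex.coe_smul, inner_smul_left, Complex.conj_ofReal]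

theorem one_sub_norm_le (b z : En n) (hz : ‖z‖ ≤ 1) : 1 - ‖b‖ ≤ ‖(1 - inner ℂ b z : ℂ)‖ := by
  have h1 := norm_inner_le_norm (𝕜 := ℂ) b z
  have h2 := norm_sub_norm_le (1 : ℂ) (inner ℂ b z)
  rw [norm_one] at h2
  nlinarith [norm_nonneg b]

/-- The size of the Szegő-type kernel integral with exponent `2n`. -/
theorem exists_lintegral_kernel_le (hn : 1 ≤ n) :
    ∃ C : ℝ≥0∞, C ≠ ⊤ ∧ ∀ b : En n, ‖b‖ < 1 →
      ∫⁻ ζ, ENNReal.ofReal ((‖(1 - inner ℂ b ζ : ℂ)‖ ^ (2 * n))⁻¹) ∂(sigmaS n) ≤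
        C * ENNReal.ofReal (((1 - ‖b‖) ^ n)⁻¹) := by
  obtain ⟨C, hC, hcap⟩ := exists_sigmaS_cap_le hn
  have hsum : (∑' k : ℕ, ENNReal.ofReal ((1 / 2 : ℝ) ^ k)) ≠ ⊤ :=
    summable_geometric_two.tsum_ofReal_ne_top
  refine ⟨C * ENNReal.ofReal (4 ^ n) * ∑' k : ℕ, ENNReal.ofReal ((1 / 2 : ℝ) ^ k),
    by finiteness, fun b hb => ?_⟩
  set δ := 1 - ‖b‖ with hδ
  have hδ0 : 0 < δ := by linarith
  obtain ⟨e, he, hbe⟩ := exists_unit_smul_eq hn b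
  have hsub : ∀ t, δ ≤ t → sigmaS n {ζ | ‖(1 - inner ℂ b ζ : ℂ)‖ < t} ≤
      C * ENNReal.ofReal ((2 * t) ^ n) := fun t ht => by
    refine (measure_mono_ae ?_).trans (hcap e he (2 * t) (by linarith))
    filter_upwards [ae_sigmaS_norm_eq_one n] with ζ hζ hζt
    have h1 : ‖(1 - inner ℂ b ζ : ℂ)‖ < t := hζt
    change ‖(1 - inner ℂ e ζ : ℂ)‖ < 2 * t
    have h2 : (1 - inner ℂ e ζ : ℂ) = (1 - inner ℂ b ζ) - ((1 - ‖b‖ : ℝ) : ℂ) * inner ℂ e ζ := by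
      have h4 : (inner ℂ b ζ : ℂ) = ‖b‖ * inner ℂ e ζ := by
        rw [← inner_real_smul_left, ← hbe]
      rw [h4]; push_cast; ring
    have h3 : ‖(inner ℂ e ζ : ℂ)‖ ≤ 1 := by
      simpa [he, hζ] using norm_inner_le_norm (𝕜 := ℂ) e ζ
    rw [h2]
    refine (norm_sub_le _ _).trans_lt ?_
    rw [norm_mul, Complex.norm_real, Real.norm_of_nonneg hδ0.le]
    nlinarith
  have hmeas : ∀ t : ℝ, MeasurableSet {ζ : En n | ‖(1 - inner ℂ b ζ : ℂ)‖ < t} := fun t =>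
    (isOpen_lt (continuous_const.sub (innerSL ℂ b).continuous).norm
      continuous_const).measurableSet
  calc ∫⁻ ζ, ENNReal.ofReal ((‖(1 - inner ℂ b ζ : ℂ)‖ ^ (2 * n))⁻¹) ∂(sigmaS n)
      ≤ ∫⁻ ζ, ∑' k : ℕ, {ζ : En n | ‖(1 - inner ℂ b ζ : ℂ)‖ < 2 ^ (k + 1) * δ}.indicator
          (fun _ => ENNReal.ofReal (((2 ^ k * δ) ^ (2 * n))⁻¹)) ζ ∂(sigmaS n) := by
        refine lintegral_mono_ae ?_
        filter_upwards [ae_sigmaS_norm_eq_one n] with ζ hζ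
        have h1 := one_sub_norm_le b ζ hζ.le
        obtain ⟨k, hk, hk'⟩ := exists_nat_pow_near ((one_le_div hδ0).2 h1) one_lt_two
        rw [le_div_iff₀ hδ0] at hk
        rw [div_lt_iff₀ hδ0] at hk'
        refine le_trans ?_ (ENNReal.le_tsum k)
        rw [indicator_of_mem (by exact hk')]
        gcongr
    _ = ∑' k : ℕ, ENNReal.ofReal (((2 ^ k * δ) ^ (2 * n))⁻¹) *
          sigmaS n {ζ : En n | ‖(1 - inner ℂ b ζ : ℂ)‖ < 2 ^ (k + 1) * δ} := by
        rw [lintegral_tsum fun k => (measurable_const.indicator (hmeas _)).aemeasurable]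
        simp only [lintegral_indicator_const (hmeas _)]
    _ ≤ ∑' k : ℕ, C * ENNReal.ofReal (4 ^ n) * ENNReal.ofReal ((δ ^ n)⁻¹) *
          ENNReal.ofReal ((1 / 2 : ℝ) ^ k) := by
        refine ENNReal.tsum_le_tsum fun k => ?_
        have h2k : (1 : ℝ) ≤ 2 ^ k := one_le_pow₀ one_le_two
        refine (mul_le_mul_right (hsub (2 ^ (k + 1) * δ) ?_) _).trans ?_
        · nlinarith [pow_succ (2 : ℝ) k]
        rw [mul_left_comm, mul_assoc C, mul_assoc C, ← ENNReal.ofReal_mul (by positivity),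
          ← ENNReal.ofReal_mul (by positivity), ← ENNReal.ofReal_mul (by positivity)]
        refine mul_le_mul_right (ENNReal.ofReal_le_ofReal ?_) _
        have h1 : ((2 ^ k * δ) ^ (2 * n))⁻¹ * (2 * (2 ^ (k + 1) * δ)) ^ n =
            4 ^ n * (δ ^ n)⁻¹ * ((2 ^ k) ^ n)⁻¹ := by
          have : (2 : ℝ) * (2 ^ (k + 1) * δ) = 4 * (2 ^ k * δ) := by rw [pow_succ]; ring
          rw [this, two_mul n, pow_add, mul_pow 4, mul_pow (2 ^ k)]
          field_simp
        rw [h1, one_div, inv_pow]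
        gcongr
        exact le_self_pow₀ h2k (by omega)
    _ = _ := by rw [ENNReal.tsum_mul_left]; ring

/-- The normalized kernel functions testing boundedness on `H^p`. -/
def testFun (n : ℕ) (p : ℝ) (a z : En n) : ℂ :=
  (((1 - ‖a‖ ^ 2) ^ (n / p) : ℝ) : ℂ) / (1 - inner ℂ a z) ^ ((2 * n / p : ℝ) : ℂ)

theorem one_sub_inner_mem_slitPlane {a z : En n} (ha : ‖a‖ < 1) (hz : ‖z‖ ≤ 1) :
    (1 - inner ℂ a z : ℂ) ∈ Complex.slitPlane := by
  refine Or.inl ?_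
  have h1 := norm_inner_le_norm (𝕜 := ℂ) a z
  have h2 := Complex.re_le_norm (inner ℂ a z : ℂ)
  simp only [Complex.sub_re, Complex.one_re]
  nlinarith [norm_nonneg a]

theorem differentiableOn_testFun (p : ℝ) {a : En n} (ha : ‖a‖ < 1) :
    DifferentiableOn ℂ (testFun n p a) (Bn n) := by
  intro z hz
  have hz1 : ‖z‖ ≤ 1 := (mem_ball_zero_iff.1 hz).le
  have hm := one_sub_inner_mem_slitPlane ha hz1
  refine DifferentiableAt.differentiableWithinAt ?_
  unfold testFun
  simp only [div_eq_mul_inv]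
  refine (DifferentiableAt.fun_inv ?_ ?_).const_mul _
  · exact ((differentiableAt_const _).sub (innerSL ℂ a).differentiableAt).cpow_const hm
  · simp [Complex.cpow_eq_zero_iff, Complex.slitPlane_ne_zero hm]

theorem norm_testFun (p : ℝ) {a z : En n} (ha : ‖a‖ < 1) :
    ‖testFun n p a z‖ = (1 - ‖a‖ ^ 2) ^ (n / p) / ‖(1 - inner ℂ a z : ℂ)‖ ^ (2 * n / p) := by
  have : 0 ≤ 1 - ‖a‖ ^ 2 := by nlinarith [norm_nonneg a]
  rw [testFun, norm_div, Complex.norm_real, Complex.norm_cpow_real,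
    Real.norm_of_nonneg (by positivity)]

theorem testFun_self {p : ℝ} {a : En n} (ha : ‖a‖ < 1) :
    ‖testFun n p a a‖ = ((1 - ‖a‖ ^ 2) ^ (n / p))⁻¹ := by
  have h0 : 0 < 1 - ‖a‖ ^ 2 := by nlinarith [norm_nonneg a]
  have h1 : ‖(1 - inner ℂ a a : ℂ)‖ = 1 - ‖a‖ ^ 2 := by
    rw [inner_self_eq_norm_sq_to_K]
    have : (1 - ((‖a‖ : ℝ) : ℂ) ^ 2) = ((1 - ‖a‖ ^ 2 : ℝ) : ℂ) := by push_cast; ring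
    exact (congrArg norm this).trans (by rw [Complex.norm_real, Real.norm_of_nonneg h0.le])
  rw [norm_testFun p ha, h1, div_eq_iff (by positivity), ← Real.rpow_neg h0.le,
    ← Real.rpow_add h0]
  congr 1; ring

theorem exists_hNorm_testFun_le (hn : 1 ≤ n) {p : ℝ} (hp : 0 < p) :
    ∃ M : ℝ≥0∞, M < ⊤ ∧ ∀ a : En n, ‖a‖ < 1 → hNorm n p (testFun n p a) ≤ M := by
  obtain ⟨C, hC, h⟩ := exists_lintegral_kernel_le hn
  refine ⟨(C * ENNReal.ofReal (2 ^ n)) ^ (1 / p),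
    ENNReal.rpow_lt_top_of_nonneg (by positivity) (by finiteness), fun a ha => ?_⟩
  refine ENNReal.rpow_le_rpow (iSup₂_le fun r hr => ?_) (by positivity)
  have h0 : 0 < 1 - ‖a‖ ^ 2 := by nlinarith [norm_nonneg a]
  have hra : ‖r • a‖ = r * ‖a‖ := by rw [norm_smul, Real.norm_of_nonneg hr.1.le]
  have hra1 : r * ‖a‖ ≤ ‖a‖ := by nlinarith [norm_nonneg a, hr.2]
  calc ∫⁻ ζ, (‖testFun n p a (r • ζ)‖₊ : ℝ≥0∞) ^ p ∂(sigmaS n)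
      = ∫⁻ ζ, ENNReal.ofReal ((1 - ‖a‖ ^ 2) ^ n) *
          ENNReal.ofReal ((‖(1 - inner ℂ (r • a) ζ : ℂ)‖ ^ (2 * n))⁻¹) ∂(sigmaS n) := by
        refine lintegral_congr fun ζ => ?_
        have h1 : (inner ℂ a (r • ζ) : ℂ) = inner ℂ (r • a) ζ := by
          rw [inner_real_smul_left, ← Complex.coe_smul, inner_smul_right]
        rw [← ENNReal.ofReal_mul (by positivity), ← enorm_eq_nnnorm, ← ofReal_norm,
          ENNReal.ofReal_rpow_of_nonneg (norm_nonneg _) hp.le, norm_testFun p ha, h1,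
          Real.div_rpow (by positivity) (by positivity), ← Real.rpow_mul h0.le,
          ← Real.rpow_mul (norm_nonneg _), div_mul_cancel₀ _ hp.ne',
          div_mul_cancel₀ _ hp.ne', div_eq_mul_inv, Real.rpow_natCast,
          ← Real.rpow_natCast _ (2 * n)]
        push_cast; rfl
    _ ≤ ENNReal.ofReal ((1 - ‖a‖ ^ 2) ^ n) *
          (C * ENNReal.ofReal (((1 - ‖r • a‖) ^ n)⁻¹)) := by
        rw [lintegral_const_mul' _ _ ENNReal.ofReal_ne_top]
        gcongr
        exact h _ (by rw [hra]; linarith)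
    _ ≤ C * ENNReal.ofReal (2 ^ n) := by
        rw [mul_left_comm, ← ENNReal.ofReal_mul (by positivity)]
        gcongr
        rw [hra, ← div_eq_mul_inv, ← div_pow]
        refine pow_le_pow_left₀ (div_nonneg h0.le (by linarith)) ?_ n
        rw [div_le_iff₀ (by linarith)]
        nlinarith [norm_nonneg a]

theorem memHp_testFun (hn : 1 ≤ n) {p : ℝ} (hp : 0 < p) {a : En n} (ha : ‖a‖ < 1) :
    MemHp n p (testFun n p a) := by
  obtain ⟨M, hM, h⟩ := exists_hNorm_testFun_le hn hp
  exact ⟨differentiableOn_testFun p ha, (h a ha).trans_lt hM⟩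

/-- Test functions tend to zero locally uniformly as the parameter approaches the sphere. -/
theorem tendstoUniformlyOn_testFun (hn : 1 ≤ n) {p : ℝ} (hp : 0 < p) {a : ℕ → En n}
    (ha : ∀ k, ‖a k‖ < 1) (hlim : Tendsto (fun k => ‖a k‖) atTop (𝓝 1)) {K : Set (En n)}
    (hK : K ⊆ Bn n) (hKc : IsCompact K) :
    TendstoUniformlyOn (fun k => testFun n p (a k)) 0 atTop K := by
  rcases K.eq_empty_or_nonempty with rfl | hne
  · exact tendstoUniformlyOn_empty
  obtain ⟨x, hxK, hx⟩ := hKc.exists_isMaxOn hne continuous_norm.continuousOn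
  have hx1 : ‖x‖ < 1 := mem_ball_zero_iff.1 (hK hxK)
  have hnp : 0 < (n : ℝ) / p := by positivity
  have ht : Tendsto (fun k => (1 - ‖a k‖ ^ 2) ^ ((n : ℝ) / p) / (1 - ‖x‖) ^ (2 * n / p))
      atTop (𝓝 0) := by
    have h1 : Tendsto (fun k => (1 - ‖a k‖ ^ 2)) atTop (𝓝 (1 - 1 ^ 2)) :=
      (hlim.pow 2).const_sub 1
    have h2 := (h1.rpow_const (p := (n : ℝ) / p) (Or.inr hnp.le)).div_const
      ((1 - ‖x‖) ^ (2 * n / p))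
    simpa [Real.zero_rpow hnp.ne'] using h2
  rw [Metric.tendstoUniformlyOn_iff]
  intro ε hε
  filter_upwards [ht.eventually_lt_const hε] with k hk z hz
  rw [Pi.zero_apply, dist_zero_left, norm_testFun p (ha k)]
  refine lt_of_le_of_lt ?_ hk
  have h0 : 0 < 1 - ‖a k‖ ^ 2 := by nlinarith [norm_nonneg (a k), ha k]
  have h3 : 1 - ‖x‖ ≤ ‖(1 - inner ℂ (a k) z : ℂ)‖ := by
    have h4 := one_sub_norm_le z (a k) (ha k).le
    have h5 : ‖(1 - inner ℂ (a k) z : ℂ)‖ = ‖(1 - inner ℂ z (a k) : ℂ)‖ := by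
      rw [← inner_conj_symm, ← Complex.norm_conj]
      simp
    have h6 : ‖z‖ ≤ ‖x‖ := hx hz
    rw [h5]; linarith
  have h7 : 0 < 1 - ‖x‖ := by linarith
  gcongr

end TestFunctions

section PointwiseEstimate

open Real

variable {n : ℕ}

theorem measurePreserving_circleMap_smul (θ : ℝ) :
    MeasurePreserving (fun v : En n => circleMap 0 1 θ • v) (fullHausdorff (En n))
      (fullHausdorff (En n)) := by
  have hc : ‖circleMap 0 1 θ‖ = 1 := by simp
  have hc0 : circleMap 0 1 θ ≠ 0 := circleMap_ne_center one_ne_zero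
  let e : En n ≃ᵢ En n :=
    { toFun := fun v => circleMap 0 1 θ • v
      invFun := fun v => (circleMap 0 1 θ)⁻¹ • v
      left_inv := fun v => inv_smul_smul₀ hc0 v
      right_inv := fun v => smul_inv_smul₀ hc0 v
      isometry_toFun := Isometry.of_dist_eq fun x y => by
        rw [dist_eq_norm, dist_eq_norm, ← smul_sub, norm_smul, hc, one_mul] }
  exact e.measurePreserving_hausdorffMeasure _

/-- Sub-mean value property of `‖G‖ ^ q` over the unit ball, for functions holomorphic on
complex lines through the origin. -/
theorem enorm_rpow_mul_le_setLIntegral_ball {q : ℝ} (hq : 0 < q) {G : En n → ℂ}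
    (hG : Measurable G)
    (hGa : ∀ v : En n, ‖v‖ < 1 → AnalyticOnNhd ℂ (fun l : ℂ => G (l • v)) (closedBall 0 1)) :
    fullHausdorff (En n) (ball 0 1) * ‖G 0‖ₑ ^ q ≤
      ∫⁻ v in ball 0 1, ‖G v‖ₑ ^ q ∂(fullHausdorff (En n)) := by
  have hF : Measurable fun v => ‖G v‖ₑ ^ q := hG.enorm.pow_const q
  have hpi : ENNReal.ofReal (2 * π) ≠ 0 := by simp [pi_pos]
  have hrot : ∀ θ : ℝ, ∫⁻ v in ball 0 1, ‖G (circleMap 0 1 θ • v)‖ₑ ^ q ∂(fullHausdorff (En n)) =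
      ∫⁻ v in ball 0 1, ‖G v‖ₑ ^ q ∂(fullHausdorff (En n)) := fun θ => by
    have h1 := (measurePreserving_circleMap_smul (n := n) θ).setLIntegral_comp_preimage
      (measurableSet_ball (x := 0) (ε := 1)) hF
    have h2 : (fun v : En n => circleMap 0 1 θ • v) ⁻¹' ball 0 1 = ball 0 1 := by
      ext v; simp [norm_smul]
    rwa [h2] at h1
  have hjoint : Measurable (Function.uncurry fun (v : En n) (θ : ℝ) =>
      ‖G (circleMap 0 1 θ • v)‖ₑ ^ q) := by
    refine hF.comp (Continuous.measurable ?_)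
    exact ((continuous_circleMap 0 1).comp continuous_snd).smul continuous_fst
  have key : ENNReal.ofReal (2 * π) * (fullHausdorff (En n) (ball 0 1) * ‖G 0‖ₑ ^ q) ≤
      ENNReal.ofReal (2 * π) * ∫⁻ v in ball 0 1, ‖G v‖ₑ ^ q ∂(fullHausdorff (En n)) := by
    calc ENNReal.ofReal (2 * π) * (fullHausdorff (En n) (ball 0 1) * ‖G 0‖ₑ ^ q)
        = ∫⁻ v in ball 0 1, ENNReal.ofReal (2 * π) * ‖G 0‖ₑ ^ q ∂(fullHausdorff (En n)) := by
          rw [setLIntegral_const]; ring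
      _ ≤ ∫⁻ v in ball 0 1, (∫⁻ θ in Ioc 0 (2 * π), ‖G (circleMap 0 1 θ • v)‖ₑ ^ q)
            ∂(fullHausdorff (En n)) := by
          refine setLIntegral_mono' measurableSet_ball fun v hv => ?_
          simpa using enorm_rpow_le_lintegral_circle hq (hGa v (by simpa using hv))
      _ = ∫⁻ θ in Ioc 0 (2 * π), ∫⁻ v in ball 0 1, ‖G (circleMap 0 1 θ • v)‖ₑ ^ q
            ∂(fullHausdorff (En n)) := lintegral_lintegral_swap hjoint.aemeasurable
      _ = _ := by
          simp only [hrot]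
          rw [setLIntegral_const, Real.volume_Ioc, sub_zero, mul_comm]
  exact (ENNReal.mul_le_mul_iff_right hpi ENNReal.ofReal_ne_top).1 key

/-- The anisotropic dilation of the ball adapted to an interior point stays in a shell. -/
theorem anisoDilation_mem_shell {e : En n} (he : ‖e‖ = 1) {δ : ℝ} (hδ : 0 < δ) (hδ1 : δ ≤ 1)
    {v : En n} (hv : ‖v‖ ≤ 1) :
    1 - 2 * δ ≤ ‖(1 - δ) • e + anisoDilation e (√δ / 4) √δ v‖ ∧
      ‖(1 - δ) • e + anisoDilation e (√δ / 4) √δ v‖ < 1 := by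
  have hs : 0 < √δ := Real.sqrt_pos.2 hδ
  have hsq : √δ ^ 2 = δ := Real.sq_sqrt hδ.le
  set T := anisoDilation e (√δ / 4) √δ v with hT
  have hee : (inner ℂ e e : ℂ) = 1 := by rw [inner_self_eq_norm_sq_to_K, he]; simp
  have hev : ‖(inner ℂ e v : ℂ)‖ ≤ 1 := by
    have := norm_inner_le_norm (𝕜 := ℂ) e v
    rw [he] at this; linarith
  have hT1 : (inner ℂ e T : ℂ) = ((δ / 4 : ℝ) : ℂ) * inner ℂ e v := by
    rw [hT, anisoDilation_apply, inner_smul_right, inner_add_right, inner_smul_right, hee]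
    nth_rw 3 [← hsq]
    push_cast; ring
  have hT1n : ‖(inner ℂ e T : ℂ)‖ ≤ δ / 4 := by
    rw [hT1, norm_mul, Complex.norm_real, Real.norm_of_nonneg (by positivity)]
    nlinarith
  have hT2 : ‖T‖ ^ 2 ≤ δ / 16 := by
    rw [hT, anisoDilation_apply, norm_smul, mul_pow, norm_sq_add_smul_inner he,
      Complex.norm_real, Real.norm_of_nonneg (by positivity), div_pow, hsq]
    have h1 : ‖v‖ ^ 2 ≤ 1 := pow_le_one₀ (norm_nonneg _) hv
    have h2 : (δ - 1) * ‖(inner ℂ e v : ℂ)‖ ^ 2 ≤ 0 :=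
      mul_nonpos_of_nonpos_of_nonneg (by linarith) (by positivity)
    nlinarith
  have hwe : ‖(1 - δ) • e‖ = 1 - δ := by
    rw [norm_smul, he, mul_one, Real.norm_of_nonneg (by linarith)]
  constructor
  · have h1 : (inner ℂ e ((1 - δ) • e + T) : ℂ) = ((1 - δ : ℝ) : ℂ) + inner ℂ e T := by
      rw [inner_add_right, ← Complex.coe_smul, inner_smul_right, hee, mul_one]
    have h2 := norm_inner_le_norm (𝕜 := ℂ) e ((1 - δ) • e + T)
    rw [h1, he, one_mul] at h2
    have h3 := norm_sub_norm_le ((1 - δ : ℝ) : ℂ) (-inner ℂ e T)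
    rw [sub_neg_eq_add, norm_neg, Complex.norm_real, Real.norm_of_nonneg (by linarith)] at h3
    linarith
  · refine lt_of_pow_lt_pow_left₀ 2 one_pos.le ?_
    have h4 : RCLike.re (inner ℂ ((1 - δ) • e) T : ℂ) ≤ (1 - δ) * (δ / 4) := by
      rw [inner_real_smul_left]
      refine (RCLike.re_le_norm _).trans ?_
      rw [norm_mul, Complex.norm_real, Real.norm_of_nonneg (by linarith)]
      gcongr
    rw [norm_add_sq (𝕜 := ℂ), hwe]
    nlinarith

/-- Pointwise growth of slice-holomorphic functions in terms of their Hardy quasinorm. -/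
theorem exists_enorm_rpow_le_iSup (hn : 1 ≤ n) :
    ∃ C : ℝ≥0∞, C ≠ ⊤ ∧ ∀ q : ℝ, 0 < q → ∀ H : En n → ℂ, Measurable H →
      (∀ w v : En n, DifferentiableOn ℂ (fun l : ℂ => H (w + l • v)) {l | w + l • v ∈ Bn n}) →
      ∀ w : En n, ‖w‖ < 1 → ‖H w‖ₑ ^ q ≤ C * ENNReal.ofReal (((1 - ‖w‖) ^ n)⁻¹) *
        ⨆ r ∈ Ioo (0 : ℝ) 1, ∫⁻ ζ, ‖H (r • ζ)‖ₑ ^ q ∂(sigmaS n) := by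
  obtain ⟨c, hc, hshell⟩ := exists_setLIntegral_shell_le hn
  have hV : fullHausdorff (En n) (ball 0 1) ≠ ⊤ := measure_ball_lt_top.ne
  have hV0 : fullHausdorff (En n) (ball 0 1) ≠ 0 := (measure_ball_pos _ _ one_pos).ne'
  refine ⟨(fullHausdorff (En n) (ball 0 1))⁻¹ * (c * ENNReal.ofReal (2 * 16 ^ n)),
    by finiteness, fun q hq H hH hHs w hw => ?_⟩
  set M := ⨆ r ∈ Ioo (0 : ℝ) 1, ∫⁻ ζ, ‖H (r • ζ)‖ₑ ^ q ∂(sigmaS n) with hM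
  obtain ⟨e, he, hwe⟩ := exists_unit_smul_eq hn w
  set δ := 1 - ‖w‖ with hδ
  have hδ0 : 0 < δ := by linarith
  have hδ1 : δ ≤ 1 := by linarith [norm_nonneg w]
  have hwe' : w = (1 - δ) • e := by rw [hδ, sub_sub_cancel]; exact hwe
  set T := anisoDilation e (√δ / 4) √δ with hT
  have hdet : LinearMap.det (T.restrictScalars ℝ) = (δ / 16) ^ n * δ := by
    rw [det_anisoDilation he, div_pow, Real.sq_sqrt hδ0.le]; norm_num
  have hTm : Measurable fun v => T v := (LinearMap.continuous_of_finiteDimensional T).measurable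
  have hΦ : Measurable fun v => w + T v := hTm.const_add w
  have hF : Measurable fun z => ‖H z‖ₑ ^ q := hH.enorm.pow_const q
  set S : Set (En n) := {z | 1 - 2 * δ ≤ ‖z‖ ∧ ‖z‖ < 1} with hS
  have hSm : MeasurableSet S := (measurableSet_le measurable_const measurable_norm).inter
      (measurableSet_lt measurable_norm measurable_const)
  have hmem : ∀ v : En n, ‖v‖ ≤ 1 → w + T v ∈ S := fun v hv => by
    rw [hwe']; exact anisoDilation_mem_shell he hδ0 hδ1 hv
  have hsub := enorm_rpow_mul_le_setLIntegral_ball hq (hH.comp hΦ) fun v hv => by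
    have hopen : IsOpen {l : ℂ | w + l • T v ∈ Bn n} :=
      isOpen_ball.preimage (by fun_prop)
    have h1 := (hHs w (T v)).analyticOnNhd hopen
    have h2 : (fun l : ℂ => (H ∘ fun v => w + T v) (l • v)) = fun l => H (w + l • T v) := by
      funext l; simp
    rw [h2]
    refine h1.mono fun l hl => ?_
    have h3 := (hmem (l • v) (by
      rw [norm_smul]
      exact mul_le_one₀ (by simpa using hl) (norm_nonneg _) hv.le)).2
    rw [map_smul] at h3
    exact mem_ball_zero_iff.2 h3
  have hcv : ∫⁻ v, S.indicator (fun z => ‖H z‖ₑ ^ q) (w + T v) ∂(fullHausdorff (En n)) =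
      ENNReal.ofReal (((δ / 16) ^ n * δ)⁻¹) * ∫⁻ z in S, ‖H z‖ₑ ^ q ∂(fullHausdorff (En n)) := by
    have hdet0 : LinearMap.det (T.restrictScalars ℝ) ≠ 0 := by rw [hdet]; positivity
    have h1 := Measure.map_linearMap_addHaar_eq_smul_addHaar (fullHausdorff (En n)) hdet0
    rw [hdet, abs_of_pos (by positivity)] at h1
    have hg : Measurable fun z => S.indicator (fun z => ‖H z‖ₑ ^ q) (w + z) :=
      (hF.indicator hSm).comp (measurable_const_add w)
    calc ∫⁻ v, S.indicator (fun z => ‖H z‖ₑ ^ q) (w + T v) ∂(fullHausdorff (En n))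
        = ∫⁻ z, S.indicator (fun z => ‖H z‖ₑ ^ q) (w + z)
            ∂(Measure.map (T.restrictScalars ℝ) (fullHausdorff (En n))) :=
          (lintegral_map hg hTm).symm
      _ = _ := by
          rw [h1, lintegral_smul_measure, lintegral_add_left_eq_self
            (fun z => S.indicator (fun z => ‖H z‖ₑ ^ q) z), lintegral_indicator hSm, smul_eq_mul]
  have hfin : fullHausdorff (En n) (ball 0 1) * ‖H w‖ₑ ^ q ≤
      (c * ENNReal.ofReal (2 * 16 ^ n)) * ENNReal.ofReal ((δ ^ n)⁻¹) * M := by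
    calc fullHausdorff (En n) (ball 0 1) * ‖H w‖ₑ ^ q
        ≤ ∫⁻ v in ball 0 1, ‖H (w + T v)‖ₑ ^ q ∂(fullHausdorff (En n)) := by
          simpa using hsub
      _ ≤ ∫⁻ v, S.indicator (fun z => ‖H z‖ₑ ^ q) (w + T v) ∂(fullHausdorff (En n)) := by
          refine le_trans ?_ (setLIntegral_le_lintegral (ball 0 1) _)
          refine setLIntegral_mono' measurableSet_ball fun v hv => ?_
          rw [indicator_of_mem (hmem v (mem_ball_zero_iff.1 hv).le)]
      _ ≤ ENNReal.ofReal (((δ / 16) ^ n * δ)⁻¹) *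
            (c * (ENNReal.ofReal (1 - (1 - 2 * δ)) * M)) := by
          rw [hcv]
          gcongr
          exact hshell _ hF _
      _ = c * (ENNReal.ofReal (((δ / 16) ^ n * δ)⁻¹) * ENNReal.ofReal (1 - (1 - 2 * δ))) * M := by
          ring
      _ = _ := by
          rw [mul_assoc c (ENNReal.ofReal (2 * 16 ^ n)), ← ENNReal.ofReal_mul (by positivity),
            ← ENNReal.ofReal_mul (by positivity)]
          congr 3
          rw [div_pow]
          field_simp
          ring
  calc ‖H w‖ₑ ^ q = (fullHausdorff (En n) (ball 0 1))⁻¹ *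
        (fullHausdorff (En n) (ball 0 1) * ‖H w‖ₑ ^ q) := by
        rw [← mul_assoc, ENNReal.inv_mul_cancel hV0 hV, one_mul]
    _ ≤ _ := by
        refine (mul_le_mul_right hfin _).trans_eq ?_
        ring

/-- Pointwise growth of continuous slice-holomorphic functions on the ball. -/
theorem exists_enorm_le_hNorm (hn : 1 ≤ n) {q : ℝ} (hq : 0 < q) :
    ∃ C : ℝ≥0∞, C ≠ ⊤ ∧ ∀ H : En n → ℂ, ContinuousOn H (Bn n) →
      (∀ w v : En n, DifferentiableOn ℂ (fun l : ℂ => H (w + l • v)) {l | w + l • v ∈ Bn n}) →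
      ∀ w ∈ Bn n, ‖H w‖ₑ ≤ C * ENNReal.ofReal ((1 - ‖w‖) ^ (-(n / q))) * hNorm n q H := by
  obtain ⟨C, hC, h⟩ := exists_enorm_rpow_le_iSup hn
  refine ⟨C ^ (1 / q), ENNReal.rpow_ne_top_of_nonneg (by positivity) hC, fun H hH hHs w hw => ?_⟩
  have hw1 : ‖w‖ < 1 := mem_ball_zero_iff.1 hw
  have hBm : MeasurableSet (Bn n) := measurableSet_ball
  have hmeas : Measurable ((Bn n).indicator H) := by
    classical
    have := hH.measurable_piecewise (g := 0) continuousOn_const hBm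
    rwa [Set.piecewise_eq_indicator] at this
  have h1 := h q hq _ hmeas
    (fun w v => (hHs w v).congr fun l hl => indicator_of_mem (s := Bn n) hl _) w hw1
  rw [indicator_of_mem hw] at h1
  have h2 : (⨆ r ∈ Ioo (0 : ℝ) 1, ∫⁻ ζ, ‖(Bn n).indicator H (r • ζ)‖ₑ ^ q ∂(sigmaS n)) =
      ⨆ r ∈ Ioo (0 : ℝ) 1, ∫⁻ ζ, (‖H (r • ζ)‖₊ : ℝ≥0∞) ^ q ∂(sigmaS n) := by
    refine biSup_congr fun r hr => lintegral_congr_ae ?_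
    filter_upwards [ae_sigmaS_norm_eq_one n] with ζ hζ
    have : r • ζ ∈ Bn n := by
      refine mem_ball_zero_iff.2 ?_
      rw [norm_smul, hζ, Real.norm_of_nonneg hr.1.le]; linarith [hr.2]
    rw [indicator_of_mem this, enorm_eq_nnnorm]
  rw [h2] at h1
  have h3 := ENNReal.rpow_le_rpow h1 (by positivity : (0 : ℝ) ≤ 1 / q)
  rw [← ENNReal.rpow_mul, mul_one_div_cancel hq.ne', ENNReal.rpow_one,
    ENNReal.mul_rpow_of_nonneg _ _ (by positivity), ENNReal.mul_rpow_of_nonneg _ _ (by positivity),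
    ENNReal.ofReal_rpow_of_nonneg (by have := sub_pos.2 hw1; positivity) (by positivity)] at h3
  refine h3.trans_eq ?_
  rw [hNorm]
  congr 3
  rw [← Real.rpow_natCast, ← Real.rpow_neg (by linarith), ← Real.rpow_mul (by linarith)]
  congr 1; ring

end PointwiseEstimate

section ParametricIntegrals

variable {X Y : Type*} [TopologicalSpace X] [TopologicalSpace Y] [MeasurableSpace Y]
  [OpensMeasurableSpace Y] {μ : Measure Y} [IsFiniteMeasureOnCompacts μ] {K : Set Y}

theorem continuousOn_setIntegral_of_isCompact [FirstCountableTopology X] [LocallyCompactSpace X]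
    {V : Set X} (hV : IsOpen V) (hK : IsCompact K) (hKm : MeasurableSet K) {F : X → Y → ℂ}
    (hF : ContinuousOn (Function.uncurry F) (V ×ˢ K)) :
    ContinuousOn (fun x => ∫ y in K, F x y ∂μ) V := by
  intro x₀ hx₀
  obtain ⟨U, hU, hxU, hUV⟩ := exists_compact_subset hV hx₀
  obtain ⟨M, hM⟩ := ((hU.prod hK).bddAbove_image (hF.mono (prod_mono_left hUV)).norm)
  have hUn : U ∈ 𝓝 x₀ := mem_interior_iff_mem_nhds.1 hxU
  refine ContinuousAt.continuousWithinAt (continuousAt_of_dominated (bound := fun _ => M) ?_ ?_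
    (integrableOn_const hK.measure_ne_top) ?_)
  · filter_upwards [hUn] with x hx
    exact (hF.comp (f := fun y => (x, y)) (by fun_prop)
      fun y hy => ⟨hUV hx, hy⟩).aestronglyMeasurable hKm
  · filter_upwards [hUn] with x hx
    filter_upwards [ae_restrict_mem hKm] with y hy
    exact hM (mem_image_of_mem _ (mk_mem_prod hx hy))
  · filter_upwards [ae_restrict_mem hKm] with y hy
    exact (hF.comp (f := fun x => (x, y)) (by fun_prop)
      fun x hx => ⟨hx, hy⟩).continuousAt (hV.mem_nhds hx₀)

/-- Integrals of holomorphic functions depending continuously on a compact parameter are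
holomorphic. -/
theorem differentiableOn_setIntegral_of_isCompact {V : Set ℂ} (hV : IsOpen V) (hK : IsCompact K)
    (hKm : MeasurableSet K) {F : ℂ → Y → ℂ}
    (hF : ContinuousOn (Function.uncurry F) (V ×ˢ K))
    (hd : ∀ y ∈ K, DifferentiableOn ℂ (fun x => F x y) V) :
    DifferentiableOn ℂ (fun x => ∫ y in K, F x y ∂μ) V := by
  intro x₀ hx₀
  obtain ⟨r, hr, hrV⟩ := Metric.isOpen_iff.1 hV x₀ hx₀
  have hUV : closedBall x₀ (r / 2) ⊆ V := (closedBall_subset_ball (by linarith)).trans hrV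
  obtain ⟨M, hM⟩ := (((isCompact_closedBall x₀ (r / 2)).prod hK).bddAbove_image
    (hF.mono (prod_mono_left hUV)).norm)
  have hmeas : ∀ x ∈ V, AEStronglyMeasurable (F x) (μ.restrict K) := fun x hx =>
    (hF.comp (f := fun y => (x, y)) (by fun_prop) fun y hy => ⟨hx, hy⟩).aestronglyMeasurable hKm
  have hball : ∀ x ∈ ball x₀ (r / 4), closedBall x (r / 4) ⊆ closedBall x₀ (r / 2) :=
    fun x hx => closedBall_subset_closedBall' (by linarith [mem_ball.1 hx])
  have hderiv : ∀ y ∈ K, ∀ x ∈ V, HasDerivAt (F · y) (deriv (F · y) x) x := fun y hy x hx =>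
    ((hd y hy).differentiableAt (hV.mem_nhds hx)).hasDerivAt
  refine (hasDerivAt_integral_of_dominated_loc_of_deriv_le (μ := μ.restrict K) (F := F)
    (F' := fun x y => deriv (F · y) x) (bound := fun _ => M / (r / 4))
    (ball_mem_nhds x₀ (by positivity : 0 < r / 4)) ?_ ?_ ?_ ?_
    (integrableOn_const hK.measure_ne_top) ?_).2.differentiableAt.differentiableWithinAt
  · filter_upwards [hV.mem_nhds hx₀] with x hx using hmeas x hx
  · refine Integrable.mono' (g := fun _ => M) (integrableOn_const hK.measure_ne_top)
      (hmeas x₀ hx₀) ?_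
    filter_upwards [ae_restrict_mem hKm] with y hy
    exact hM (mem_image_of_mem _ (mk_mem_prod (mem_closedBall_self (by positivity)) hy))
  · have hseq : Tendsto (fun k : ℕ => (((r / 2) * (1 / ((k : ℝ) + 1)) : ℝ) : ℂ)) atTop
        (𝓝[≠] 0) := by
      rw [tendsto_nhdsWithin_iff]
      constructor
      · rw [← Complex.ofReal_zero]
        refine (Complex.continuous_ofReal.tendsto 0).comp ?_
        simpa using tendsto_one_div_add_atTop_nhds_zero_nat.const_mul (r / 2)
      · refine Eventually.of_forall fun k => ?_
        simp only [mem_compl_iff, mem_singleton_iff, Complex.ofReal_eq_zero]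
        positivity
    refine aestronglyMeasurable_of_tendsto_ae atTop (f := fun (k : ℕ) y =>
      (((r / 2) * (1 / ((k : ℝ) + 1)) : ℝ) : ℂ)⁻¹ •
        (F (x₀ + (((r / 2) * (1 / ((k : ℝ) + 1)) : ℝ) : ℂ)) y - F x₀ y)) (fun k => ?_) ?_
    · refine AEStronglyMeasurable.const_smul ((hmeas _ (hUV ?_)).sub (hmeas _ hx₀))
        ((((r / 2) * (1 / ((k : ℝ) + 1)) : ℝ) : ℂ)⁻¹)
      rw [mem_closedBall, dist_self_add_left, Complex.norm_real,
        Real.norm_of_nonneg (by positivity)]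
      refine mul_le_of_le_one_right (by positivity) ?_
      rw [div_le_one (by positivity)]
      linarith [k.cast_nonneg (α := ℝ)]
    · filter_upwards [ae_restrict_mem hKm] with y hy
      exact (hasDerivAt_iff_tendsto_slope_zero.1 (hderiv y hy x₀ hx₀)).comp hseq
  · filter_upwards [ae_restrict_mem hKm] with y hy x hx
    have hsub := hball x hx
    refine Complex.norm_deriv_le_of_forall_mem_sphere_norm_le (by positivity) ?_ fun z hz =>
      hM (mem_image_of_mem _ (mk_mem_prod (hsub (sphere_subset_closedBall hz)) hy))
    exact ((hd y hy).mono ((closure_ball_subset_closedBall.trans hsub).trans hUV)).diffContOnCl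
  · filter_upwards [ae_restrict_mem hKm] with y hy x hx
    exact hderiv y hy x (hUV (hball x hx (mem_closedBall_self (by positivity))))

end ParametricIntegrals

section Regularity

open Real

variable {n : ℕ} {f g : En n → ℂ}

theorem hasDerivAt_comp_smul (hg : DifferentiableOn ℂ g (Bn n)) {z : En n} {l : ℂ}
    (h : l • z ∈ Bn n) :
    HasDerivAt (fun l : ℂ => g (l • z)) (fderiv ℂ g (l • z) z) l := by
  have h1 := (hg.differentiableAt (isOpen_ball.mem_nhds h)).hasFDerivAt
  have h2 : HasDerivAt (fun l : ℂ => l • z) z l := by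
    simpa using (hasDerivAt_id l).smul_const z
  exact h1.comp_hasDerivAt l h2

theorem smul_mem_Bn {z : En n} (hz : z ∈ Bn n) {l : ℂ} (hl : ‖l‖ ≤ 1) : l • z ∈ Bn n := by
  rw [Bn, mem_ball_zero_iff, norm_smul] at *
  nlinarith [norm_nonneg z]

theorem isOpen_smul_mem_Bn (z : En n) : IsOpen {l : ℂ | l • z ∈ Bn n} :=
  isOpen_ball.preimage (continuous_id.smul continuous_const)

theorem differentiableOn_comp_smul (hg : DifferentiableOn ℂ g (Bn n)) (z : En n) :
    DifferentiableOn ℂ (fun l : ℂ => g (l • z)) {l | l • z ∈ Bn n} := fun _ hl =>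
  (hasDerivAt_comp_smul hg hl).differentiableAt.differentiableWithinAt

theorem radD_smul (hg : DifferentiableOn ℂ g (Bn n)) {z : En n} {l : ℂ} (h : l • z ∈ Bn n) :
    radD g (l • z) = l * deriv (fun l : ℂ => g (l • z)) l := by
  rw [(hasDerivAt_comp_smul hg h).deriv, radD, map_smul, smul_eq_mul]

theorem J_eq_integral_deriv (hg : DifferentiableOn ℂ g (Bn n)) {z : En n} (hz : z ∈ Bn n) :
    J g f z = ∫ t in Ioo (0 : ℝ) 1,
      f ((t : ℂ) • z) * deriv (fun l : ℂ => g (l • z)) (t : ℂ) := by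
  refine setIntegral_congr_fun measurableSet_Ioo fun t ht => ?_
  have ht0 : (t : ℂ) ≠ 0 := mod_cast ht.1.ne'
  have h1 : (t : ℂ) • z ∈ Bn n := smul_mem_Bn hz (by
    rw [Complex.norm_real, norm_of_nonneg ht.1.le]; exact ht.2.le)
  simp only [← Complex.coe_smul]
  rw [radD_smul hg h1]
  field_simp

/-- The integrand representing `J g f` through Cauchy's formula on circles of radius `r`. -/
def cauchyKernel (g f : En n → ℂ) (r : ℝ) (z : En n) (y : ℝ × ℝ) : ℂ :=
  f ((y.1 : ℂ) • z) * ((2 * π * Complex.I)⁻¹ * (deriv (circleMap 0 r) y.2 *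
    ((circleMap 0 r y.2 ^ 2)⁻¹ * g (circleMap y.1 r y.2 • z))))

theorem smul_mem_Bn_of_mem_closedBall {r : ℝ} {z : En n} (hz : (1 + r) * ‖z‖ < 1) {t : ℝ}
    (ht : t ∈ Icc (0 : ℝ) 1) {l : ℂ} (hl : l ∈ closedBall (t : ℂ) r) : l • z ∈ Bn n := by
  rw [Bn, mem_ball_zero_iff, norm_smul]
  have h1 : ‖l‖ ≤ 1 + r := by
    have h2 := norm_le_norm_add_norm_sub' l (t : ℂ)
    rw [Complex.norm_real, norm_of_nonneg ht.1] at h2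
    rw [mem_closedBall, dist_eq_norm] at hl
    linarith [ht.2]
  nlinarith [norm_nonneg z]

theorem ofReal_smul_mem_Bn {r : ℝ} (hr : 0 < r) {z : En n} (hz : (1 + r) * ‖z‖ < 1) {t : ℝ}
    (ht : t ∈ Icc (0 : ℝ) 1) : (t : ℂ) • z ∈ Bn n :=
  smul_mem_Bn_of_mem_closedBall hz ht (mem_closedBall_self hr.le)

theorem continuousOn_cauchyKernel (hf : DifferentiableOn ℂ f (Bn n))
    (hg : DifferentiableOn ℂ g (Bn n)) {r : ℝ} (hr : 0 < r) :
    ContinuousOn (Function.uncurry (cauchyKernel g f r))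
      ({z : En n | (1 + r) * ‖z‖ < 1} ×ˢ (Icc (0 : ℝ) 1 ×ˢ Icc 0 (2 * π))) := by
  have hc0 : ∀ θ, circleMap 0 r θ ^ 2 ≠ 0 := fun θ =>
    pow_ne_zero 2 (circleMap_ne_center hr.ne')
  have hfc : ContinuousOn (fun x : En n × (ℝ × ℝ) => f ((x.2.1 : ℂ) • x.1))
      ({z : En n | (1 + r) * ‖z‖ < 1} ×ˢ (Icc (0 : ℝ) 1 ×ˢ Icc 0 (2 * π))) :=
    hf.continuousOn.comp (by fun_prop) fun x hx => ofReal_smul_mem_Bn hr hx.1 hx.2.1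
  have hgc : ContinuousOn
      (fun x : En n × (ℝ × ℝ) => g (circleMap (x.2.1 : ℂ) r x.2.2 • x.1))
      ({z : En n | (1 + r) * ‖z‖ < 1} ×ˢ (Icc (0 : ℝ) 1 ×ˢ Icc 0 (2 * π))) := by
    refine hg.continuousOn.comp ?_ fun x hx => smul_mem_Bn_of_mem_closedBall hx.1 hx.2.1
      (circleMap_mem_closedBall _ hr.le _)
    simp only [circleMap]
    fun_prop
  have hk : Continuous fun x : En n × (ℝ × ℝ) => deriv (circleMap 0 r) x.2.2 := by
    simp only [deriv_circleMap]
    exact ((continuous_circleMap 0 r).comp (continuous_snd.comp continuous_snd)).mul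
      continuous_const
  have hk2 : Continuous fun x : En n × (ℝ × ℝ) => (circleMap 0 r x.2.2 ^ 2)⁻¹ :=
    (((continuous_circleMap 0 r).comp (continuous_snd.comp continuous_snd)).pow 2).inv₀
      fun x => hc0 _
  exact hfc.mul (continuousOn_const.mul (hk.continuousOn.mul (hk2.continuousOn.mul hgc)))

theorem J_eq_integral_cauchyKernel (hf : DifferentiableOn ℂ f (Bn n))
    (hg : DifferentiableOn ℂ g (Bn n)) {r : ℝ} (hr : 0 < r) {z : En n}
    (hz : (1 + r) * ‖z‖ < 1) :
    J g f z = ∫ y in Icc (0 : ℝ) 1 ×ˢ Icc 0 (2 * π), cauchyKernel g f r z y := by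
  have hzB : z ∈ Bn n := by
    rw [Bn, mem_ball_zero_iff]; nlinarith [norm_nonneg z]
  have h_int : IntegrableOn (cauchyKernel g f r z) (Icc (0 : ℝ) 1 ×ˢ Icc 0 (2 * π))
      (volume.prod volume) := by
    refine ContinuousOn.integrableOn_compact (isCompact_Icc.prod isCompact_Icc) ?_
    exact (continuousOn_cauchyKernel hf hg hr).comp (f := fun y => (z, y)) (by fun_prop)
      fun y hy => ⟨hz, hy⟩
  rw [Measure.volume_eq_prod, setIntegral_prod _ h_int, J_eq_integral_deriv hg hzB,
    integral_Icc_eq_integral_Ioo]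
  refine setIntegral_congr_fun measurableSet_Ioo fun t ht => ?_
  have hsub : closedBall (t : ℂ) r ⊆ {l : ℂ | l • z ∈ Bn n} := fun l hl =>
    smul_mem_Bn_of_mem_closedBall hz (Ioo_subset_Icc_self ht) hl
  have h1 := ((differentiableOn_comp_smul hg z).mono hsub).deriv_eq_smul_circleIntegral hr
  have h2 : deriv (fun l : ℂ => g (l • z)) (t : ℂ) = (2 * π * Complex.I)⁻¹ *
      ∮ l in C((t : ℂ), r), (1 / (l - t) ^ 2) • g (l • z) := by
    rw [h1, smul_eq_mul, inv_mul_cancel_left₀ Complex.two_pi_I_ne_zero]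
  simp only [cauchyKernel]
  rw [h2, circleIntegral, intervalIntegral.integral_of_le (by positivity),
    integral_Icc_eq_integral_Ioc, integral_const_mul, integral_const_mul]
  congr 2
  refine setIntegral_congr_fun measurableSet_Ioc fun θ _ => ?_
  simp [deriv_circleMap, circleMap]

theorem exists_one_add_mul_norm_lt {z : En n} (hz : z ∈ Bn n) :
    ∃ r : ℝ, 0 < r ∧ (1 + r) * ‖z‖ < 1 := by
  have h1 : ‖z‖ < 1 := mem_ball_zero_iff.1 hz
  refine ⟨1 - ‖z‖, by linarith, ?_⟩
  nlinarith [norm_nonneg z]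

theorem continuousOn_J (hf : DifferentiableOn ℂ f (Bn n)) (hg : DifferentiableOn ℂ g (Bn n)) :
    ContinuousOn (J g f) (Bn n) := by
  intro z hz
  obtain ⟨r, hr, hrz⟩ := exists_one_add_mul_norm_lt hz
  have hV : IsOpen {z : En n | (1 + r) * ‖z‖ < 1} :=
    isOpen_lt (continuous_const.mul continuous_norm) continuous_const
  have h1 := continuousOn_setIntegral_of_isCompact (μ := volume) hV
    (isCompact_Icc.prod isCompact_Icc) (measurableSet_Icc.prod measurableSet_Icc)
    (continuousOn_cauchyKernel hf hg hr)
  exact ((h1.congr fun z hz => J_eq_integral_cauchyKernel hf hg hr hz).continuousAt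
    (hV.mem_nhds hrz)).continuousWithinAt

/-- `J g f` is holomorphic along complex lines. -/
theorem differentiableOn_J_slice (hf : DifferentiableOn ℂ f (Bn n))
    (hg : DifferentiableOn ℂ g (Bn n)) (w v : En n) :
    DifferentiableOn ℂ (fun l : ℂ => J g f (w + l • v)) {l | w + l • v ∈ Bn n} := by
  intro l₀ hl₀
  obtain ⟨r, hr, hrz⟩ := exists_one_add_mul_norm_lt hl₀
  have hL : Continuous fun l : ℂ => w + l • v := by fun_prop
  have hV : IsOpen {l : ℂ | (1 + r) * ‖w + l • v‖ < 1} :=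
    isOpen_lt (continuous_const.mul hL.norm) continuous_const
  have hcont : ContinuousOn (Function.uncurry fun (l : ℂ) => cauchyKernel g f r (w + l • v))
      ({l : ℂ | (1 + r) * ‖w + l • v‖ < 1} ×ˢ (Icc (0 : ℝ) 1 ×ˢ Icc 0 (2 * π))) :=
    (continuousOn_cauchyKernel hf hg hr).comp
      (f := fun x : ℂ × (ℝ × ℝ) => (w + x.1 • v, x.2)) (by fun_prop)
      fun x hx => ⟨hx.1, hx.2⟩
  have hslice : ∀ (h : En n → ℂ), DifferentiableOn ℂ h (Bn n) → ∀ (c l : ℂ),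
      c • (w + l • v) ∈ Bn n → DifferentiableAt ℂ (fun l : ℂ => h (c • (w + l • v))) l :=
    fun h hh c l hl => by
      have h1 := hh.differentiableAt (isOpen_ball.mem_nhds hl)
      exact h1.comp l (f := fun l : ℂ => c • (w + l • v)) (by fun_prop)
  have h1 := differentiableOn_setIntegral_of_isCompact (μ := volume) hV
    (isCompact_Icc.prod isCompact_Icc) (measurableSet_Icc.prod measurableSet_Icc) hcont
    fun y hy l hl => by
      refine DifferentiableAt.differentiableWithinAt ?_
      unfold cauchyKernel
      exact (hslice f hf _ _ (ofReal_smul_mem_Bn hr hl hy.1)).mul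
        (((hslice g hg _ _ (smul_mem_Bn_of_mem_closedBall hl hy.1
          (circleMap_mem_closedBall _ hr.le _))).const_mul _ |>.const_mul _).const_mul _)
  exact ((h1.congr fun z hz => J_eq_integral_cauchyKernel hf hg hr hz).differentiableAt
    (hV.mem_nhds hrz)).differentiableWithinAt

theorem differentiableOn_J_smul (hf : DifferentiableOn ℂ f (Bn n))
    (hg : DifferentiableOn ℂ g (Bn n)) (a : En n) :
    DifferentiableOn ℂ (fun l : ℂ => J g f (l • a)) {l | l • a ∈ Bn n} := by
  simpa using differentiableOn_J_slice hf hg 0 a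

/-- The radial derivative of `J g f` is `f * Rg`. -/
theorem deriv_J_smul (hf : DifferentiableOn ℂ f (Bn n)) (hg : DifferentiableOn ℂ g (Bn n))
    {a : En n} (ha : a ∈ Bn n) : deriv (fun l : ℂ => J g f (l • a)) 1 = f a * radD g a := by
  have ha1 : (1 : ℂ) • a ∈ Bn n := by simpa using ha
  have hO := isOpen_smul_mem_Bn a
  set W : Set ℝ := Complex.ofReal ⁻¹' {l : ℂ | l • a ∈ Bn n} with hW
  have hWo : IsOpen W := hO.preimage Complex.continuous_ofReal
  set φ : ℝ → ℂ := fun u => f ((u : ℂ) • a) * deriv (fun l : ℂ => g (l • a)) u with hφ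
  have hφc : ContinuousOn φ W := by
    refine ContinuousOn.mul ?_ ?_
    · exact hf.continuousOn.comp (by fun_prop) fun u hu => hu
    · exact ((differentiableOn_comp_smul hg a).deriv hO).continuousOn.comp
        Complex.continuous_ofReal.continuousOn fun u hu => hu
  have h1W : (1 : ℝ) ∈ W := by simpa [hW] using ha
  have hIW : uIcc (0 : ℝ) 1 ⊆ W := fun u hu => by
    rw [uIcc_of_le zero_le_one] at hu
    refine smul_mem_Bn ha ?_
    rw [Complex.norm_real, norm_of_nonneg hu.1]; exact hu.2
  have hftc := intervalIntegral.integral_hasDerivAt_right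
    (hφc.mono hIW).intervalIntegrable (hφc.stronglyMeasurableAtFilter hWo 1 h1W)
    (hφc.continuousAt (hWo.mem_nhds h1W))
  have heq : (fun s : ℝ => J g f ((s : ℂ) • a)) =ᶠ[𝓝 1] fun s => ∫ u in (0 : ℝ)..s, φ u := by
    filter_upwards [hWo.mem_nhds h1W, lt_mem_nhds zero_lt_one] with s hs hs0
    rw [J_eq_integral_deriv hg hs, ← integral_Ioc_eq_integral_Ioo,
      ← intervalIntegral.integral_of_le zero_le_one]
    have h2 := intervalIntegral.smul_integral_comp_mul_left (a := 0) (b := 1) φ s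
    rw [mul_zero, mul_one, ← intervalIntegral.integral_smul] at h2
    rw [← h2]
    refine intervalIntegral.integral_congr fun t ht => ?_
    rw [uIcc_of_le zero_le_one] at ht
    have h3 : ((t : ℂ) * s) • a ∈ Bn n := by
      rw [← smul_smul]
      exact smul_mem_Bn hs (by rw [Complex.norm_real, norm_of_nonneg ht.1]; exact ht.2)
    have h4 : deriv (fun l : ℂ => g (l • (s : ℂ) • a)) t =
        s * deriv (fun l : ℂ => g (l • a)) (t * s) := by
      rw [(hasDerivAt_comp_smul hg (by rwa [smul_smul])).deriv, (hasDerivAt_comp_smul hg h3).deriv,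
        map_smul, smul_smul, smul_eq_mul]
    simp only [hφ]
    rw [h4, smul_smul, Complex.real_smul, Complex.ofReal_mul, mul_comm (s : ℂ) t]
    ring
  have hk := ((differentiableOn_J_smul hf hg a).differentiableAt
    (hO.mem_nhds ha1)).hasDerivAt
  have hk1 : HasDerivAt (fun s : ℝ => J g f ((s : ℂ) • a))
      (deriv (fun l : ℂ => J g f (l • a)) 1) 1 := HasDerivAt.comp_ofReal (z := 1)
    (by rw [Complex.ofReal_one]; exact hk)
  rw [hk1.unique (hftc.congr_of_eventuallyEq heq)]
  have h5 := radD_smul hg ha1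
  rw [one_smul, one_mul] at h5
  simp [hφ, h5]

/-- Growth of `f * Rg` in terms of the Hardy quasinorm of `J g f`. -/
theorem exists_norm_mul_radD_le (hn : 1 ≤ n) {q : ℝ} (hq : 0 < q) :
    ∃ C : ℝ, ∀ f g : En n → ℂ, DifferentiableOn ℂ f (Bn n) → DifferentiableOn ℂ g (Bn n) →
      hNorm n q (J g f) ≠ ⊤ → ∀ a ∈ Bn n,
        ‖f a‖ * ‖radD g a‖ ≤
          C * ((1 - ‖a‖) / 2) ^ (-(n / q) - 1) * (hNorm n q (J g f)).toReal := by
  obtain ⟨C, hC, h⟩ := exists_enorm_le_hNorm hn hq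
  refine ⟨C.toReal, fun f g hf hg hN a ha => ?_⟩
  have ha1 : ‖a‖ < 1 := mem_ball_zero_iff.1 ha
  set δ := 1 - ‖a‖ with hδ
  have hδ0 : 0 < δ := by linarith
  have hnorm : ∀ l ∈ closedBall (1 : ℂ) (δ / 2), ‖l • a‖ ≤ 1 - δ / 2 := fun l hl => by
    have h2 := norm_le_norm_add_norm_sub' l 1
    rw [norm_one] at h2
    rw [mem_closedBall, dist_eq_norm] at hl
    rw [norm_smul]
    have : ‖a‖ = 1 - δ := by linarith
    nlinarith [norm_nonneg a]
  have hmem : closedBall (1 : ℂ) (δ / 2) ⊆ {l : ℂ | l • a ∈ Bn n} := fun l hl =>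
    mem_ball_zero_iff.2 ((hnorm l hl).trans_lt (by linarith))
  have hB : ∀ l ∈ sphere (1 : ℂ) (δ / 2), ‖J g f (l • a)‖ ≤
      C.toReal * (δ / 2) ^ (-(n / q)) * (hNorm n q (J g f)).toReal := fun l hl => by
    have hl' := sphere_subset_closedBall hl
    have h1 := h (J g f) (continuousOn_J hf hg) (differentiableOn_J_slice hf hg) _ (hmem hl')
    have h2 : (1 - ‖l • a‖) ^ (-(n / q)) ≤ (δ / 2) ^ (-(n / q)) :=
      rpow_le_rpow_of_nonpos (by positivity) (by linarith [hnorm l hl'])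
        (neg_nonpos.2 (by positivity))
    have h3 := h1.trans (mul_le_mul_left (mul_le_mul_right (ENNReal.ofReal_le_ofReal h2) C) _)
    have h4 := ENNReal.toReal_mono (by finiteness) h3
    rwa [ENNReal.toReal_mul, ENNReal.toReal_mul, ENNReal.toReal_ofReal (by positivity),
      toReal_enorm] at h4
  have hd : DiffContOnCl ℂ (fun l : ℂ => J g f (l • a)) (ball 1 (δ / 2)) :=
    ((differentiableOn_J_smul hf hg a).mono
      (closure_ball_subset_closedBall.trans hmem)).diffContOnCl
  have h5 := Complex.norm_deriv_le_of_forall_mem_sphere_norm_le (by positivity) hd hB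
  rw [deriv_J_smul hf hg ha, norm_mul] at h5
  refine h5.trans_eq ?_
  rw [rpow_sub_one (by positivity)]
  ring

end Regularity

section Conclusion

variable {n : ℕ} {f g : En n → ℂ}

/-- Maximum principle for the radial derivative. -/
theorem exists_norm_eq_norm_radD_le (hn : 1 ≤ n) (hg : DifferentiableOn ℂ g (Bn n)) {z : En n}
    {r : ℝ} (hr0 : 0 < r) (hr1 : r < 1) (hz : ‖z‖ ≤ r) :
    ∃ a : En n, ‖a‖ = r ∧ ‖radD g z‖ ≤ ‖radD g a‖ := by
  obtain ⟨e, he, hze⟩ := exists_unit_smul_eq hn z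
  have hsub : closedBall (0 : ℂ) r ⊆ {l : ℂ | l • e ∈ Bn n} := fun l hl => by
    rw [mem_closedBall_zero_iff] at hl
    simp only [mem_ofPred_eq, Bn, mem_ball_zero_iff, norm_smul, he, mul_one]
    linarith
  have hd : DifferentiableOn ℂ (fun l : ℂ => radD g (l • e)) (closedBall 0 r) := by
    refine DifferentiableOn.congr (f := fun l => l * deriv (fun l : ℂ => g (l • e)) l) ?_
      fun l hl => radD_smul hg (hsub hl)
    exact differentiableOn_id.mul
      (((differentiableOn_comp_smul hg e).deriv (isOpen_smul_mem_Bn e)).mono hsub)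
  obtain ⟨w, hw, hmax⟩ := Complex.exists_mem_frontier_isMaxOn_norm (isBounded_ball (x := (0 : ℂ)))
    (nonempty_ball.2 hr0) (hd.diffContOnCl_ball subset_rfl)
  rw [frontier_ball _ hr0.ne', mem_sphere_zero_iff_norm] at hw
  rw [closure_ball _ hr0.ne'] at hmax
  refine ⟨w • e, by rw [norm_smul, he, hw, mul_one], ?_⟩
  have h := hmax (show ((‖z‖ : ℝ) : ℂ) ∈ closedBall 0 r by simpa using hz)
  simp only [mem_ofPred_eq, Function.comp_apply] at h
  rwa [Complex.coe_smul, ← hze] at h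

theorem eq_apply_zero_of_radD_eq_zero (hg : DifferentiableOn ℂ g (Bn n))
    (h : ∀ z ∈ Bn n, radD g z = 0) {z : En n} (hz : z ∈ Bn n) : g z = g 0 := by
  have hmem : ∀ t ∈ Icc (0 : ℝ) 1, ((1 - t : ℝ) : ℂ) • z ∈ Bn n := fun t ht =>
    smul_mem_Bn hz (by
      rw [Complex.norm_real, Real.norm_of_nonneg (by linarith [ht.2])]; linarith [ht.1])
  have hd : ∀ t ∈ Icc (0 : ℝ) 1, HasDerivAt (fun t : ℝ => g (((1 - t : ℝ) : ℂ) • z))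
      (-(fderiv ℂ g (((1 - t : ℝ) : ℂ) • z) z)) t := fun t ht => by
    have h1 := (hasDerivAt_comp_smul hg (hmem t ht)).comp_ofReal
    have h2 := h1.scomp t ((hasDerivAt_id t).const_sub 1)
    rw [neg_one_smul] at h2
    exact h2
  have hc := constant_of_has_deriv_right_zero
    (fun t ht => (hd t ht).continuousAt.continuousWithinAt) (fun t ht => ?_) 1
    (right_mem_Icc.2 zero_le_one)
  · simpa using hc.symm
  · have h0 : ((1 - t : ℝ) : ℂ) ≠ 0 := by
      rw [Complex.ofReal_ne_zero]; linarith [ht.2]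
    have h1 := h _ (hmem t (Ico_subset_Icc_self ht))
    rw [radD, map_smul, smul_eq_mul, mul_eq_zero, or_iff_right h0] at h1
    have h2 := hd t (Ico_subset_Icc_self ht)
    rw [h1, neg_zero] at h2
    exact h2.hasDerivWithinAt

theorem J_eq_zero_of_const (h : ∀ z ∈ Bn n, g z = g 0) (f : En n → ℂ) {z : En n}
    (hz : z ∈ Bn n) : J g f z = 0 := by
  refine setIntegral_eq_zero_of_forall_eq_zero fun t ht => ?_
  have hm : t • z ∈ Bn n := by
    rw [← Complex.coe_smul]
    exact smul_mem_Bn hz (by rw [Complex.norm_real, Real.norm_of_nonneg ht.1.le]; exact ht.2.le)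
  have he : g =ᶠ[𝓝 (t • z)] fun _ => g 0 :=
    Filter.eventually_of_mem (isOpen_ball.mem_nhds hm) h
  simp [radD, he.fderiv_eq]

theorem hNorm_eq_zero {q : ℝ} (hq : 0 < q) (h : ∀ z ∈ Bn n, f z = 0) : hNorm n q f = 0 := by
  have h1 : ⨆ r ∈ Ioo (0 : ℝ) 1,
      ∫⁻ ζ, (‖f (r • ζ)‖₊ : ℝ≥0∞) ^ q ∂(sigmaS n) = 0 := by
    simp only [ENNReal.iSup_eq_zero]
    intro r hr
    rw [lintegral_congr_ae (g := fun _ => 0), lintegral_zero]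
    filter_upwards [ae_sigmaS_norm_eq_one n] with ζ hζ
    rw [h (r • ζ) (by
      rw [Bn, mem_ball_zero_iff, norm_smul, hζ, mul_one, Real.norm_of_nonneg hr.1.le]; exact hr.2)]
    simp [hq]
  rw [hNorm, h1, ENNReal.zero_rpow_of_pos (by positivity)]

theorem exists_norm_radD_le_of_testFun (hn : 1 ≤ n) {p q : ℝ} (hp : 0 < p) (hq : 0 < q)
    (hα : (n : ℝ) * (1 / p - 1 / q) = 1) :
    ∃ C : ℝ, ∀ g : En n → ℂ, DifferentiableOn ℂ g (Bn n) → ∀ a ∈ Bn n,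
      hNorm n q (J g (testFun n p a)) ≠ ⊤ →
        ‖radD g a‖ ≤ C * (hNorm n q (J g (testFun n p a))).toReal := by
  obtain ⟨C, hC⟩ := exists_norm_mul_radD_le hn hq
  refine ⟨4 ^ (n / p) * |C|, fun g hg a ha hN => ?_⟩
  have ha1 : ‖a‖ < 1 := mem_ball_zero_iff.1 ha
  have h := hC _ g (differentiableOn_testFun p ha1) hg hN a ha
  set N := (hNorm n q (J g (testFun n p a))).toReal
  have hN0 : 0 ≤ N := ENNReal.toReal_nonneg
  rw [testFun_self ha1] at h
  set s := (1 - ‖a‖) / 2 with hs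
  have hs0 : 0 < s := by linarith
  have hb : 0 < 1 - ‖a‖ ^ 2 := by nlinarith [norm_nonneg a]
  have hb4 : 1 - ‖a‖ ^ 2 ≤ 4 * s := by nlinarith [norm_nonneg a]
  have hB : 0 < (1 - ‖a‖ ^ 2) ^ (n / p) := Real.rpow_pos_of_pos hb _
  rw [inv_mul_le_iff₀ hB] at h
  have hexp : (n : ℝ) / p + (-(n / q) - 1) = 0 := by
    rw [mul_sub, mul_one_div, mul_one_div] at hα; linarith
  calc ‖radD g a‖ ≤ (1 - ‖a‖ ^ 2) ^ (n / p) * (C * s ^ (-(n / q) - 1) * N) := h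
    _ ≤ (4 * s) ^ (n / p) * (|C| * s ^ (-(n / q) - 1) * N) := by
        have := Real.rpow_nonneg hs0.le (-(n / q) - 1)
        refine mul_le_mul (Real.rpow_le_rpow hb.le hb4 (by positivity)) ?_ ?_ ?_
        · gcongr; exact le_abs_self C
        · have h2 := (norm_nonneg (radD g a)).trans h
          exact nonneg_of_mul_nonneg_right h2 hB
        · positivity
    _ = 4 ^ (n / p) * |C| * (s ^ (n / p) * s ^ (-(n / q) - 1)) * N := by
        rw [Real.mul_rpow (by norm_num) hs0.le]; ring
    _ = 4 ^ (n / p) * |C| * N := by rw [← Real.rpow_add hs0, hexp, Real.rpow_zero, mul_one]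

theorem radD_eq_zero_of_tendsto (hn : 1 ≤ n) {p q : ℝ} (hp : 0 < p) (hq : 0 < q)
    (hα : (n : ℝ) * (1 / p - 1 / q) = 1) (hg : DifferentiableOn ℂ g (Bn n))
    (h : ∀ a : ℕ → En n, (∀ k, ‖a k‖ < 1) → Tendsto (fun k => ‖a k‖) atTop (𝓝 1) →
      Tendsto (fun k => hNorm n q (J g (testFun n p (a k)))) atTop (𝓝 0)) {z : En n}
    (hz : z ∈ Bn n) : radD g z = 0 := by
  have hz1 : ‖z‖ < 1 := mem_ball_zero_iff.1 hz
  obtain ⟨u, -, hu, hlim⟩ := exists_seq_strictMono_tendsto' hz1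
  choose a ha hle using fun k => exists_norm_eq_norm_radD_le hn hg
    ((norm_nonneg z).trans_lt (hu k).1) (hu k).2 (hu k).1.le
  have ha1 : ∀ k, ‖a k‖ < 1 := fun k => (ha k).trans_lt (hu k).2
  have hN := h a ha1 (by simpa only [ha] using hlim)
  obtain ⟨C, hC⟩ := exists_norm_radD_le_of_testFun hn hp hq hα
  have hR : Tendsto (fun k => C * (hNorm n q (J g (testFun n p (a k)))).toReal) atTop (𝓝 0) := by
    simpa using ((ENNReal.tendsto_toReal ENNReal.zero_ne_top).comp hN).const_mul C
  refine norm_le_zero_iff.1 (ge_of_tendsto hR ?_)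
  filter_upwards [hN.eventually_ne ENNReal.zero_ne_top] with k hk
  exact (hle k).trans (hC g hg (a k) (mem_ball_zero_iff.2 (ha1 k)) hk)

end Conclusion

/-- For `0 < p < q < ∞` with `n(1/p - 1/q) = 1` and `g` holomorphic on
`B_n`, the operator `J_g : H^p → H^q` is compact iff `g` is constant, in which case
`J_g ≡ 0` on `B_n`. -/
theorem stmt14 (n : ℕ) (hn : 1 ≤ n) (p q : ℝ) (hp : 0 < p) (hpq : p < q)
    (hα : (n : ℝ) * (1 / p - 1 / q) = 1)
    (g : En n → ℂ) (hg : DifferentiableOn ℂ g (Bn n)) :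
    ((∀ f : ℕ → En n → ℂ, (∀ k, MemHp n p (f k)) →
        (∃ M : ℝ≥0∞, M < ⊤ ∧ ∀ k, hNorm n p (f k) ≤ M) →
        (∀ K : Set (En n), K ⊆ Bn n → IsCompact K →
          TendstoUniformlyOn (fun k => f k) 0 atTop K) →
        Tendsto (fun k => hNorm n q (J g (f k))) atTop (𝓝 0)) ↔
      ∀ z ∈ Bn n, g z = g 0) ∧
    ((∀ z ∈ Bn n, g z = g 0) → ∀ f : En n → ℂ, ∀ z ∈ Bn n, J g f z = 0) := by
  have hq : 0 < q := hp.trans hpq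
  refine ⟨⟨fun h z hz => ?_, fun h f _ _ _ => ?_⟩, fun h f z hz => J_eq_zero_of_const h f hz⟩
  · refine eq_apply_zero_of_radD_eq_zero hg (fun w hw => ?_) hz
    refine radD_eq_zero_of_tendsto hn hp hq hα hg (fun a ha hlim => ?_) hw
    obtain ⟨M, hM, hle⟩ := exists_hNorm_testFun_le hn hp
    exact h _ (fun k => memHp_testFun hn hp (ha k)) ⟨M, hM, fun k => hle _ (ha k)⟩
      fun K hK hKc => tendstoUniformlyOn_testFun hn hp ha hlim hK hKc
  · simp only [fun k => hNorm_eq_zero hq fun z hz => J_eq_zero_of_const h (f k) hz]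
    exact tendsto_const_nhds

end
end

section
/- Let n ≥ 1 and let {z_j} be a separated sequence in B_n, i.e. there exists δ > 0 such that |φ_{z_i}(z_j)| ≥ δ for all i ≠ j. Then for every t > n and ε > 0 there is a constant C > 0, depending only on n, t, ε and δ, such that Σ_j (1−|z_j|²)^t / |1 − ⟨z, z_j⟩|^{t+ε} ≤ C (1−|z|²)^{−ε} for all z ∈ B_n. -/
open MeasureTheory Metric Set Filter
open scoped ENNReal NNReal Topology

noncomputable section

open scoped InnerProductSpace Pointwise

theorem herm_eq_inner {n : ℕ} (z w : En n) : herm z w = ⟪w, z⟫_ℂ := by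
  simp [herm, PiLp.inner_apply]

/-- The identity `|φ_a(z)|² = 1 - (1-|a|²)(1-|z|²)/|1-⟨z,a⟩|²`, cleared of denominators. -/
theorem norm_mob_sq_mul {n : ℕ} {a z : En n} (ha : ‖a‖ < 1) (hz : ‖z‖ < 1) :
    ‖mob a z‖ ^ 2 * ‖1 - ⟪a, z⟫_ℂ‖ ^ 2 =
      ‖1 - ⟪a, z⟫_ℂ‖ ^ 2 - (1 - ‖a‖ ^ 2) * (1 - ‖z‖ ^ 2) := by
  rcases eq_or_ne a 0 with rfl | ha0
  · simp [mob]
  have hne : 1 - ⟪a, z⟫_ℂ ≠ 0 := by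
    intro h
    have h1 : ‖⟪a, z⟫_ℂ‖ ≤ ‖a‖ * ‖z‖ := norm_inner_le_norm a z
    rw [← sub_eq_zero.mp h, norm_one] at h1
    nlinarith [norm_nonneg a, norm_nonneg z]
  have hA : (‖a‖ : ℂ) ^ 2 ≠ 0 := by simpa using ha0
  set μ : ℂ := ⟪a, z⟫_ℂ / (‖a‖ : ℂ) ^ 2 with hμ
  have hin : ⟪a, z⟫_ℂ = μ * (‖a‖ : ℂ) ^ 2 := by rw [hμ, div_mul_cancel₀ _ hA]
  set q : En n := z - μ • a with hq
  have haq : ⟪a, q⟫_ℂ = 0 := by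
    rw [hq, inner_sub_right, inner_smul_right, inner_self_eq_norm_sq_to_K, hin]
    simp
  have hz : z = μ • a + q := by simp [hq]
  have pyth (c d : ℂ) : ‖c • a + d • q‖ ^ 2 = ‖c‖ ^ 2 * ‖a‖ ^ 2 + ‖d‖ ^ 2 * ‖q‖ ^ 2 := by
    have := norm_add_sq_eq_norm_sq_add_norm_sq_of_inner_eq_zero (𝕜 := ℂ) (c • a) (d • q)
      (by simp [inner_smul_left, inner_smul_right, haq])
    rw [norm_smul, norm_smul] at this
    nlinarith [this]
  have hzn : ‖z‖ ^ 2 = ‖μ‖ ^ 2 * ‖a‖ ^ 2 + ‖q‖ ^ 2 := by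
    have := pyth μ 1
    rw [one_smul, ← hz] at this
    simpa using this
  have hmob : mob a z = (1 - ⟪a, z⟫_ℂ)⁻¹ •
      ((1 - μ) • a + (-(Real.sqrt (1 - ‖a‖ ^ 2) : ℂ)) • q) := by
    simp only [mob, if_neg ha0, herm_eq_inner, inner_self_eq_norm_sq_to_K]
    congr 1
    change (a - μ • a) - _ • q = _
    module
  have hs : Real.sqrt (1 - ‖a‖ ^ 2) ^ 2 = 1 - ‖a‖ ^ 2 :=
    Real.sq_sqrt (by nlinarith [norm_nonneg a])
  rw [hmob, norm_smul, mul_pow, pyth, norm_inv, inv_pow, mul_comm, ← mul_assoc,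
    mul_inv_cancel₀ (by simpa using hne), one_mul, norm_neg, Complex.norm_real, Real.norm_eq_abs,
    sq_abs, hs, hzn, hin]
  simp only [Complex.sq_norm, Complex.normSq_apply]
  rw [← Complex.ofReal_pow]
  simp only [Complex.sub_re, Complex.sub_im, Complex.one_re, Complex.one_im, Complex.re_mul_ofReal,
    Complex.im_mul_ofReal]
  ring

/-- The linear map that dilates by `s` orthogonally to `a` and, when `‖a‖` is close to `1`,
by about `s ^ 2` along `a`. -/
def koranyiMap {n : ℕ} (a : En n) (s : ℝ) : En n →ₗ[ℂ] En n :=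
  (s : ℂ) • LinearMap.transvection (innerSL ℂ a).toLinearMap (((s : ℂ) - 1) • a)

theorem koranyiMap_apply {n : ℕ} (a : En n) (s : ℝ) (y : En n) :
    koranyiMap a s y = (s : ℂ) • (y + (⟪a, y⟫_ℂ * ((s : ℂ) - 1)) • a) := by
  simp [koranyiMap, LinearMap.transvection.apply, smul_smul, -Complex.coe_smul]

theorem koranyiMap_det {n : ℕ} (a : En n) (s : ℝ) :
    (koranyiMap a s).det = ((s ^ n * (1 + (s - 1) * ‖a‖ ^ 2) : ℝ) : ℂ) := by
  simp [koranyiMap, LinearMap.det_smul, LinearMap.transvection.det, inner_self_eq_norm_sq_to_K,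
    -Complex.coe_smul]

theorem measureReal_image_koranyiMap {n : ℕ} (μ : Measure (En n)) [μ.IsAddHaarMeasure]
    (a : En n) (s : ℝ) (A : Set (En n)) :
    μ.real (koranyiMap a s '' A) = (s ^ n * (1 + (s - 1) * ‖a‖ ^ 2)) ^ 2 * μ.real A := by
  have h := Measure.addHaar_image_linearMap μ ((koranyiMap a s).restrictScalars ℝ) A
  rw [LinearMap.det_restrictScalars, koranyiMap_det, Algebra.norm_complex_apply] at h
  rw [Measure.real, Measure.real, ← ENNReal.toReal_ofReal (sq_nonneg (s ^ n * _)),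
    ← ENNReal.toReal_mul]
  rw [Complex.normSq_ofReal, ← pow_two, abs_of_nonneg (sq_nonneg _)] at h
  exact congrArg ENNReal.toReal h

/-- The image of a closed ball under `koranyiMap`, centered at `a`. -/
def koranyiEllipsoid {n : ℕ} (a : En n) (s ρ : ℝ) : Set (En n) :=
  (a + ·) '' (koranyiMap a s '' closedBall 0 ρ)

theorem isCompact_koranyiEllipsoid {n : ℕ} (a : En n) (s ρ : ℝ) :
    IsCompact (koranyiEllipsoid a s ρ) :=
  ((isCompact_closedBall 0 ρ).image
    (LinearMap.continuous_of_finiteDimensional (koranyiMap a s))).image (by fun_prop)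

theorem measureReal_koranyiEllipsoid {n : ℕ} (μ : Measure (En n)) [μ.IsAddHaarMeasure]
    (a : En n) (s ρ : ℝ) :
    μ.real (koranyiEllipsoid a s ρ) =
      (s ^ n * (1 + (s - 1) * ‖a‖ ^ 2)) ^ 2 * μ.real (closedBall 0 ρ) := by
  rw [← measureReal_image_koranyiMap, koranyiEllipsoid, image_add_left, Measure.real,
    measure_preimage_add, Measure.real]

theorem norm_sub_le_of_mem_koranyiEllipsoid {n : ℕ} {a u : En n} {η : ℝ} (ha : ‖a‖ < 1)
    (hu : u ∈ koranyiEllipsoid a √(1 - ‖a‖ ^ 2) η) :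
    ‖u - a‖ ≤ 2 * η * √(1 - ‖a‖ ^ 2) ∧ ‖⟪a, u - a⟫_ℂ‖ ≤ 2 * η * (1 - ‖a‖ ^ 2) := by
  obtain ⟨_, ⟨y, hy, rfl⟩, rfl⟩ := hu
  rw [mem_closedBall_zero_iff] at hy
  have hr : 0 ≤ 1 - ‖a‖ ^ 2 := by nlinarith [norm_nonneg a]
  set s := √(1 - ‖a‖ ^ 2) with hs
  have hs0 : 0 ≤ s := Real.sqrt_nonneg _
  have hs2 : s ^ 2 = 1 - ‖a‖ ^ 2 := Real.sq_sqrt hr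
  have hs1 : s ≤ 1 := by nlinarith [norm_nonneg a]
  have hin : ‖⟪a, y⟫_ℂ‖ ≤ ‖a‖ * ‖y‖ := norm_inner_le_norm a y
  have hη : 0 ≤ η := (norm_nonneg y).trans hy
  rw [add_sub_cancel_left, koranyiMap_apply]
  constructor
  · have h1 : ‖(⟪a, y⟫_ℂ * ((s : ℂ) - 1)) • a‖ ≤ ‖y‖ := by
      rw [norm_smul, norm_mul, ← Complex.ofReal_one, ← Complex.ofReal_sub, Complex.norm_real,
        Real.norm_eq_abs, abs_sub_comm, abs_of_nonneg (by linarith)]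
      calc ‖⟪a, y⟫_ℂ‖ * (1 - s) * ‖a‖ ≤ (1 * ‖y‖) * 1 * 1 := by
            have h : ‖⟪a, y⟫_ℂ‖ ≤ 1 * ‖y‖ := hin.trans (by gcongr)
            gcongr; linarith
        _ = ‖y‖ := by ring
    rw [norm_smul, Complex.norm_real, Real.norm_eq_abs, abs_of_nonneg hs0]
    calc s * ‖y + (⟪a, y⟫_ℂ * ((s : ℂ) - 1)) • a‖ ≤ s * (η + η) := by
          gcongr
          exact (norm_add_le _ _).trans (add_le_add hy (h1.trans hy))
      _ = _ := by ring
  · have h2 : ⟪a, (s : ℂ) • (y + (⟪a, y⟫_ℂ * ((s : ℂ) - 1)) • a)⟫_ℂ =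
        ((s * (1 + (s - 1) * ‖a‖ ^ 2) : ℝ) : ℂ) * ⟪a, y⟫_ℂ := by
      rw [inner_smul_right, inner_add_right, inner_smul_right, inner_self_eq_norm_sq_to_K]
      push_cast
      simp only [Complex.coe_algebraMap]
      ring
    have h3 : 0 ≤ 1 + (s - 1) * ‖a‖ ^ 2 := by nlinarith [sq_nonneg ‖a‖]
    rw [h2, norm_mul, Complex.norm_real, Real.norm_eq_abs, abs_of_nonneg (mul_nonneg hs0 h3)]
    calc s * (1 + (s - 1) * ‖a‖ ^ 2) * ‖⟪a, y⟫_ℂ‖ ≤ s * (s + s) * (1 * η) := by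
          have h4 : 1 + (s - 1) * ‖a‖ ^ 2 ≤ s + s := by nlinarith [norm_nonneg a]
          have h5 : ‖⟪a, y⟫_ℂ‖ ≤ 1 * η := hin.trans (by gcongr)
          exact mul_le_mul (mul_le_mul_of_nonneg_left h4 hs0) h5 (norm_nonneg _) (by positivity)
      _ = _ := by rw [← hs2]; ring

theorem mem_koranyiEllipsoid_of_norm_le {n : ℕ} {w v : En n} {R : ℝ} (hR : 0 < R) (hR4 : R ≤ 4)
    (hw : ‖w‖ < 1) (hv : ‖v‖ < 1) (hwR : 1 - ‖w‖ ^ 2 ≤ 2 * R)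
    (hvw : ‖1 - ⟪w, v⟫_ℂ‖ ≤ 3 * R) :
    v ∈ koranyiEllipsoid w (√R / 2) 25 := by
  set s := √R / 2 with hs
  have hsR : R = 4 * s ^ 2 := by rw [hs, div_pow, Real.sq_sqrt hR.le]; ring
  have hs0 : 0 < s := by positivity
  have hs1 : s ≤ 1 := by nlinarith
  have hden : s ≤ 1 + (s - 1) * ‖w‖ ^ 2 := by
    have : 0 ≤ 1 - ‖w‖ ^ 2 := by nlinarith [norm_nonneg w]
    nlinarith [mul_nonneg (sub_nonneg.2 hs1) this]
  set β : ℝ := (1 - s) / (1 + (s - 1) * ‖w‖ ^ 2) with hβ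
  have hβmul : β * (1 + (s - 1) * ‖w‖ ^ 2) = 1 - s := div_mul_cancel₀ _ (by linarith)
  have hβ0 : 0 ≤ β := div_nonneg (by linarith) (by linarith)
  have hβs : β * s ≤ 1 := by nlinarith
  set x := v - w with hx
  have hxn : ‖x‖ ≤ 5 * s := by
    have h1 := norm_sub_sq (𝕜 := ℂ) w v
    rw [norm_sub_rev, ← hx] at h1
    have h2 := (Complex.re_le_norm (1 - ⟪w, v⟫_ℂ)).trans hvw
    simp only [Complex.sub_re, Complex.one_re] at h2
    simp only [RCLike.re_eq_complex_re] at h1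
    refine abs_le_of_sq_le_sq' ?_ (by positivity) |>.2
    nlinarith [norm_nonneg w, norm_nonneg v]
  have hxi : ‖⟪w, x⟫_ℂ‖ ≤ 20 * s ^ 2 := by
    have h1 : ⟪w, x⟫_ℂ = -(1 - ⟪w, v⟫_ℂ) + ((1 - ‖w‖ ^ 2 : ℝ) : ℂ) := by
      rw [hx, inner_sub_right, inner_self_eq_norm_sq_to_K]
      push_cast
      simp only [Complex.coe_algebraMap]
      ring
    rw [h1]
    refine (norm_add_le _ _).trans ?_
    rw [norm_neg, Complex.norm_real, Real.norm_eq_abs,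
      abs_of_nonneg (by nlinarith [norm_nonneg w])]
    linarith
  refine ⟨x, ⟨((s⁻¹ : ℝ) : ℂ) • (x + ((β : ℂ) * ⟪w, x⟫_ℂ) • w), ?_, ?_⟩, by simp [hx]⟩
  · rw [mem_closedBall_zero_iff, norm_smul, Complex.norm_real, norm_inv, Real.norm_eq_abs,
      abs_of_pos hs0, inv_mul_le_iff₀ hs0]
    refine (norm_add_le _ _).trans ?_
    rw [norm_smul, norm_mul, Complex.norm_real, Real.norm_eq_abs, abs_of_nonneg hβ0]
    calc ‖x‖ + β * ‖⟪w, x⟫_ℂ‖ * ‖w‖ ≤ 5 * s + β * (20 * s ^ 2) * 1 := by gcongr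
      _ = 5 * s + 20 * s * (β * s) := by ring
      _ ≤ s * 25 := by nlinarith
  · have hβmul' : (β : ℂ) * (1 + (s - 1) * (‖w‖ : ℂ) ^ 2) = 1 - s := by exact_mod_cast hβmul
    rw [koranyiMap_apply, inner_smul_right, inner_add_right, inner_smul_right,
      inner_self_eq_norm_sq_to_K]
    simp only [Complex.coe_algebraMap]
    have hs' : (s : ℂ) * ((s⁻¹ : ℝ) : ℂ) = 1 := by
      rw [← Complex.ofReal_mul, mul_inv_cancel₀ hs0.ne', Complex.ofReal_one]
    have hcomb : (s : ℂ) • (((s⁻¹ : ℝ) : ℂ) • (x + ((β : ℂ) * ⟪w, x⟫_ℂ) • w) +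
        (((s⁻¹ : ℝ) : ℂ) * (⟪w, x⟫_ℂ + (β : ℂ) * ⟪w, x⟫_ℂ * (‖w‖ : ℂ) ^ 2) *
          ((s : ℂ) - 1)) • w) = ((s : ℂ) * ((s⁻¹ : ℝ) : ℂ)) • (x + (⟪w, x⟫_ℂ *
          ((β : ℂ) * (1 + (s - 1) * (‖w‖ : ℂ) ^ 2) + (s - 1))) • w) := by
      module
    rw [hcomb, hs', hβmul']
    simp

theorem norm_one_sub_inner_sq_le_of_le_norm_mob {n : ℕ} {a b : En n} {δ : ℝ} (hδ : 0 < δ)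
    (ha : ‖a‖ < 1) (hb : ‖b‖ < 1) (h : δ ≤ ‖mob a b‖) :
    (1 - ‖a‖ ^ 2) * (1 - ‖b‖ ^ 2) ≤ (1 - δ ^ 2) * ‖1 - ⟪a, b⟫_ℂ‖ ^ 2 := by
  have h1 := norm_mob_sq_mul ha hb
  have h2 : δ ^ 2 * ‖1 - ⟪a, b⟫_ℂ‖ ^ 2 ≤ ‖mob a b‖ ^ 2 * ‖1 - ⟪a, b⟫_ℂ‖ ^ 2 := by gcongr
  linarith

theorem norm_one_sub_inner_le_of_mem_koranyiEllipsoid {n : ℕ} {a b u : En n} {η h : ℝ}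
    (hη : 0 < η) (hη1 : η ≤ 1 / 16) (ha : ‖a‖ < 1) (hb : ‖b‖ < 1)
    (hah : 1 - ‖a‖ ^ 2 ≤ h) (hbh : 1 - ‖b‖ ^ 2 ≤ h) (hah' : h ≤ 2 * (1 - ‖a‖ ^ 2))
    (hua : u ∈ koranyiEllipsoid a √(1 - ‖a‖ ^ 2) η)
    (hub : u ∈ koranyiEllipsoid b √(1 - ‖b‖ ^ 2) η) :
    ‖1 - ⟪a, b⟫_ℂ‖ ≤ (1 - ‖a‖ ^ 2) * (1 + 24 * η) := by
  obtain ⟨ha1, ha2⟩ := norm_sub_le_of_mem_koranyiEllipsoid ha hua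
  obtain ⟨hb1, hb2⟩ := norm_sub_le_of_mem_koranyiEllipsoid hb hub
  have hh : 0 < h := by nlinarith [norm_nonneg a]
  have ha3 : ‖u - a‖ ≤ 2 * η * √h := ha1.trans (by gcongr)
  have hb3 : ‖u - b‖ ≤ 2 * η * √h := hb1.trans (by gcongr)
  have hab : ‖a - b‖ ≤ 4 * η * √h := by
    rw [show a - b = (u - b) - (u - a) by abel]
    exact (norm_sub_le _ _).trans (by linarith)
  have hcross : ‖⟪a - b, u - b⟫_ℂ‖ ≤ 8 * η ^ 2 * h := by
    refine (norm_inner_le_norm _ _).trans ?_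
    calc ‖a - b‖ * ‖u - b‖ ≤ (4 * η * √h) * (2 * η * √h) := by gcongr
      _ = 8 * η ^ 2 * √h ^ 2 := by ring
      _ = _ := by rw [Real.sq_sqrt hh.le]
  have hsplit : 1 - ⟪a, b⟫_ℂ = ((1 - ‖a‖ ^ 2 : ℝ) : ℂ) + (-⟪a, u - a⟫_ℂ +
      (⟪b, u - b⟫_ℂ + ⟪a - b, u - b⟫_ℂ)) := by
    have h2 : ⟪a, a⟫_ℂ = (‖a‖ : ℂ) ^ 2 := inner_self_eq_norm_sq_to_K a
    simp only [inner_sub_left, inner_sub_right, h2]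
    push_cast
    ring
  rw [hsplit]
  refine (norm_add_le _ _).trans ?_
  rw [Complex.norm_real, Real.norm_eq_abs, abs_of_nonneg (by linarith)]
  have h3 := norm_add_le (-⟪a, u - a⟫_ℂ) (⟪b, u - b⟫_ℂ + ⟪a - b, u - b⟫_ℂ)
  have h4 := norm_add_le ⟪b, u - b⟫_ℂ ⟪a - b, u - b⟫_ℂ
  rw [norm_neg] at h3
  have h5 : η * (1 - ‖a‖ ^ 2) ≤ η * h := by gcongr
  have h6 : η * (1 - ‖b‖ ^ 2) ≤ η * h := by gcongr
  have h7 : η * h ≤ η * (2 * (1 - ‖a‖ ^ 2)) := by gcongr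
  have h8 : 8 * η ^ 2 * h ≤ 8 * (η * h) := by
    have : η * (η * h) ≤ 1 * (η * h) := by gcongr; linarith
    nlinarith
  linarith

theorem disjoint_koranyiEllipsoid {n : ℕ} {a b : En n} {δ η h : ℝ} (hδ : 0 < δ)
    (hη : 0 < η) (hη1 : η ≤ 1 / 16) (hηδ : 100 * η ≤ δ ^ 2) (ha : ‖a‖ < 1) (hb : ‖b‖ < 1)
    (hah : 1 - ‖a‖ ^ 2 ≤ h) (hbh : 1 - ‖b‖ ^ 2 ≤ h) (hah' : h ≤ 2 * (1 - ‖a‖ ^ 2))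
    (hbh' : h ≤ 2 * (1 - ‖b‖ ^ 2)) (hab : δ ≤ ‖mob a b‖) :
    Disjoint (koranyiEllipsoid a √(1 - ‖a‖ ^ 2) η) (koranyiEllipsoid b √(1 - ‖b‖ ^ 2) η) := by
  rw [Set.disjoint_left]
  intro u hua hub
  have h1 := norm_one_sub_inner_le_of_mem_koranyiEllipsoid hη hη1 ha hb hah hbh hah' hua hub
  have h2 := norm_one_sub_inner_le_of_mem_koranyiEllipsoid hη hη1 hb ha hbh hah hbh' hub hua
  have hsymm : ‖1 - ⟪b, a⟫_ℂ‖ = ‖1 - ⟪a, b⟫_ℂ‖ := by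
    rw [← inner_conj_symm, ← RCLike.norm_conj (1 - ⟪a, b⟫_ℂ)]
    simp
  rw [hsymm] at h2
  have h3 := norm_one_sub_inner_sq_le_of_le_norm_mob hδ ha hb hab
  have hra : 0 < 1 - ‖a‖ ^ 2 := by nlinarith [norm_nonneg a]
  have hrb : 0 < 1 - ‖b‖ ^ 2 := by nlinarith [norm_nonneg b]
  set p := (1 - ‖a‖ ^ 2) * (1 - ‖b‖ ^ 2) with hp
  have hp0 : 0 < p := mul_pos hra hrb
  have h4 : ‖1 - ⟪a, b⟫_ℂ‖ ^ 2 ≤ p * (1 + 24 * η) ^ 2 := by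
    calc ‖1 - ⟪a, b⟫_ℂ‖ ^ 2 = ‖1 - ⟪a, b⟫_ℂ‖ * ‖1 - ⟪a, b⟫_ℂ‖ := sq _
      _ ≤ ((1 - ‖a‖ ^ 2) * (1 + 24 * η)) * ((1 - ‖b‖ ^ 2) * (1 + 24 * η)) := by gcongr
      _ = _ := by rw [hp]; ring
  have h5 : 0 < 1 - δ ^ 2 := by
    by_contra hcon
    nlinarith [sq_nonneg ‖1 - ⟪a, b⟫_ℂ‖]
  have h6 : p ≤ p * ((1 - δ ^ 2) * (1 + 24 * η) ^ 2) := by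
    calc p ≤ (1 - δ ^ 2) * ‖1 - ⟪a, b⟫_ℂ‖ ^ 2 := h3
      _ ≤ (1 - δ ^ 2) * (p * (1 + 24 * η) ^ 2) := by gcongr
      _ = _ := by ring
  have h7 : 1 ≤ (1 - δ ^ 2) * (1 + 24 * η) ^ 2 := le_of_mul_le_mul_left (by linarith) hp0
  have h8 : (1 - δ ^ 2) * (1 + 24 * η) ^ 2 ≤ (1 - 100 * η) * (1 + 24 * η) ^ 2 := by gcongr
  nlinarith [sq_nonneg η, mul_pos hη hη, mul_pos (mul_pos hη hη) hη]

theorem bounds_of_mem_koranyiEllipsoid {n : ℕ} {a u w : En n} {η h R : ℝ} (hη : 0 < η)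
    (hη1 : η ≤ 1 / 16) (ha : ‖a‖ < 1) (hw : ‖w‖ < 1) (hah : 1 - ‖a‖ ^ 2 ≤ h) (hhR : h ≤ 2 * R)
    (haw : ‖1 - ⟪a, w⟫_ℂ‖ < R) (hu : u ∈ koranyiEllipsoid a √(1 - ‖a‖ ^ 2) η) :
    0 < 1 - ‖u‖ ^ 2 ∧ 1 - ‖u‖ ^ 2 < 2 * h ∧ ‖1 - ⟪w, u⟫_ℂ‖ ≤ 2 * R := by
  obtain ⟨h1, h2⟩ := norm_sub_le_of_mem_koranyiEllipsoid ha hu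
  have hr : 0 < 1 - ‖a‖ ^ 2 := by nlinarith [norm_nonneg a]
  have hR : 0 < R := (norm_nonneg _).trans_lt haw
  have h3 : ‖u‖ ^ 2 = ‖a‖ ^ 2 + 2 * (⟪a, u - a⟫_ℂ).re + ‖u - a‖ ^ 2 := by
    have := norm_add_sq (𝕜 := ℂ) a (u - a)
    rwa [add_sub_cancel] at this
  have h4 := abs_le.1 ((Complex.abs_re_le_norm _).trans h2)
  have h5 : ‖u - a‖ ^ 2 ≤ 4 * η ^ 2 * (1 - ‖a‖ ^ 2) := by
    calc ‖u - a‖ ^ 2 ≤ (2 * η * √(1 - ‖a‖ ^ 2)) ^ 2 := by gcongr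
      _ = 4 * η ^ 2 * √(1 - ‖a‖ ^ 2) ^ 2 := by ring
      _ = _ := by rw [Real.sq_sqrt hr.le]
  have h6 : η * (1 - ‖a‖ ^ 2) ≤ 1 / 16 * (1 - ‖a‖ ^ 2) := by gcongr
  have h7 : η ^ 2 * (1 - ‖a‖ ^ 2) ≤ (1 / 16) ^ 2 * (1 - ‖a‖ ^ 2) := by gcongr
  refine ⟨by nlinarith, by nlinarith [sq_nonneg ‖u - a‖], ?_⟩
  have hwa : ‖w - a‖ ≤ 2 * √R := by
    have e1 := norm_sub_sq (𝕜 := ℂ) a w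
    rw [norm_sub_rev] at e1
    have e2 := (Complex.re_le_norm (1 - ⟪a, w⟫_ℂ)).trans haw.le
    simp only [Complex.sub_re, Complex.one_re] at e2
    simp only [RCLike.re_eq_complex_re] at e1
    refine abs_le_of_sq_le_sq' ?_ (by positivity) |>.2
    rw [mul_pow, Real.sq_sqrt hR.le]
    nlinarith [norm_nonneg w, norm_nonneg a]
  have hua : ‖u - a‖ ≤ 4 * η * √R := by
    calc ‖u - a‖ ≤ 2 * η * √(1 - ‖a‖ ^ 2) := h1
      _ ≤ 2 * η * √(2 ^ 2 * R) := by gcongr; linarith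
      _ = 4 * η * √R := by
        rw [Real.sqrt_mul (by positivity), Real.sqrt_sq (by positivity)]; ring
  have hcross : ‖⟪w - a, u - a⟫_ℂ‖ ≤ 8 * η * R := by
    refine (norm_inner_le_norm _ _).trans ?_
    calc ‖w - a‖ * ‖u - a‖ ≤ (2 * √R) * (4 * η * √R) := by gcongr
      _ = 8 * η * √R ^ 2 := by ring
      _ = _ := by rw [Real.sq_sqrt hR.le]
  have hsymm : ‖1 - ⟪w, a⟫_ℂ‖ = ‖1 - ⟪a, w⟫_ℂ‖ := by
    rw [← inner_conj_symm, ← RCLike.norm_conj (1 - ⟪a, w⟫_ℂ)]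
    simp
  have hsplit : 1 - ⟪w, u⟫_ℂ = (1 - ⟪w, a⟫_ℂ) - (⟪w - a, u - a⟫_ℂ + ⟪a, u - a⟫_ℂ) := by
    simp only [inner_sub_left, inner_sub_right]
    ring
  have e3 := norm_sub_le (1 - ⟪w, a⟫_ℂ) (⟪w - a, u - a⟫_ℂ + ⟪a, u - a⟫_ℂ)
  have e4 := norm_add_le ⟪w - a, u - a⟫_ℂ ⟪a, u - a⟫_ℂ
  have e5 : η * R ≤ 1 / 16 * R := by gcongr
  rw [hsplit]
  linarith

/-- In a separated sequence, the number of points at depth about `h` in the nonisotropic ball of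
radius `R` about `w` is at most a constant multiple of `(R / h) ^ n`. -/
theorem exists_card_le (n : ℕ) {δ : ℝ} (hδ : 0 < δ) :
    ∃ N : ℝ, 0 < N ∧ ∀ (z : ℕ → En n) (w : En n) (R h : ℝ) (S : Finset ℕ),
      (∀ j, ‖z j‖ < 1) → (∀ i j, i ≠ j → δ ≤ ‖mob (z i) (z j)‖) → ‖w‖ < 1 →
      0 < h → h ≤ 2 * R → R ≤ 4 → 1 - ‖w‖ ^ 2 ≤ 2 * R →
      (∀ j ∈ S, h ≤ 2 * (1 - ‖z j‖ ^ 2) ∧ 1 - ‖z j‖ ^ 2 ≤ h ∧ ‖1 - ⟪z j, w⟫_ℂ‖ < R) →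
      (S.card : ℝ) ≤ N * (R / h) ^ n := by
  let μ : Measure (En n) := Measure.addHaar
  let D := Module.finrank ℝ (En n)
  set η : ℝ := min (1 / 16) (δ ^ 2 / 100)
  have hη : 0 < η := by positivity
  have hη1 : η ≤ 1 / 16 := min_le_left _ _
  have hηδ : 100 * η ≤ δ ^ 2 := by
    have : η ≤ δ ^ 2 / 100 := min_le_right _ _
    linarith
  have hpos (ρ : ℝ) (hρ : 0 < ρ) : 0 < μ.real (closedBall (0 : En n) ρ) :=
    ENNReal.toReal_pos (measure_closedBall_pos μ 0 hρ).ne'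
      (isCompact_closedBall 0 ρ).measure_lt_top.ne
  set b := μ.real (closedBall (0 : En n) η)
  set M := μ.real (closedBall (0 : En n) 25)
  have hb0 : 0 < b := hpos η hη
  have hM0 : 0 < M := hpos 25 (by norm_num)
  refine ⟨16 * 81 * 2 ^ D * 2 ^ (n + 1) * M / b, by positivity, ?_⟩
  intro z w R h S hz hsep hw hh hhR hR4 hwR hS
  have hR : 0 < R := by linarith
  let K : ℕ := ⌊R / (16 * h)⌋₊ + 1
  have hK : R / (16 * h) ≤ K := by
    have := (Nat.lt_floor_add_one (R / (16 * h))).le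
    simpa [K] using this
  let q : ℕ → ℝ := fun k => √(1 - 2 * h * k)
  have hk (k : ℕ) (hkK : k < K) : 2 * h * k ≤ R / 8 := by
    have h1 : (k : ℝ) ≤ R / (16 * h) :=
      (Nat.cast_le.2 (Nat.lt_succ_iff.1 hkK)).trans (Nat.floor_le (by positivity))
    rw [le_div_iff₀ (by positivity)] at h1
    linarith
  have hq2 (k : ℕ) (hkK : k < K) : q k ^ 2 = 1 - 2 * h * k :=
    Real.sq_sqrt (by linarith [hk k hkK])
  have hq0 (k : ℕ) : 0 ≤ q k := Real.sqrt_nonneg _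
  have hq1 (k : ℕ) : q k ≤ 1 := Real.sqrt_le_one.2 (by
    have : 0 ≤ 2 * h * k := by positivity
    linarith)
  have hqhalf (k : ℕ) (hkK : k < K) : 1 / 2 ≤ q k := by
    nlinarith [hq2 k hkK, hk k hkK, hq0 k, hq1 k]
  let E : ℕ → Set (En n) := fun j => koranyiEllipsoid (z j) √(1 - ‖z j‖ ^ 2) η
  let F : ℕ × ℕ → Set (En n) := fun p => q p.2 • E p.1
  have hFc (p : ℕ × ℕ) : IsCompact (F p) := (isCompact_koranyiEllipsoid _ _ _).smul _
  have hEb (j : ℕ) (hj : j ∈ S) (u : En n) (hu : u ∈ E j) :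
      0 < 1 - ‖u‖ ^ 2 ∧ 1 - ‖u‖ ^ 2 < 2 * h ∧ ‖1 - ⟪w, u⟫_ℂ‖ ≤ 2 * R :=
    bounds_of_mem_koranyiEllipsoid hη hη1 (hz j) hw (hS j hj).2.1 hhR (hS j hj).2.2 hu
  have hdepth (j k : ℕ) (hj : j ∈ S) (hkK : k < K) (v : En n) (hv : v ∈ F (j, k)) :
      2 * h * k < 1 - ‖v‖ ^ 2 ∧ 1 - ‖v‖ ^ 2 < 2 * h * (k + 1) := by
    obtain ⟨u, hu, rfl⟩ := hv
    obtain ⟨h1, h2, -⟩ := hEb j hj u hu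
    have h3 : ‖q k • u‖ ^ 2 = (1 - 2 * h * k) * ‖u‖ ^ 2 := by
      rw [norm_smul, Real.norm_eq_abs, mul_pow, sq_abs, hq2 k hkK]
    have h4 : 0 < 1 - 2 * h * k := by linarith [hk k hkK]
    have h5 : 0 ≤ 2 * h * k := by positivity
    change 2 * h * k < 1 - ‖q k • u‖ ^ 2 ∧ 1 - ‖q k • u‖ ^ 2 < 2 * h * (k + 1)
    rw [h3]
    constructor <;> nlinarith
  have hdisj : (↑(S ×ˢ Finset.range K) : Set (ℕ × ℕ)).PairwiseDisjoint F := by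
    rintro ⟨i, k⟩ hik ⟨j, l⟩ hjl hne
    simp only [Finset.coe_product, Finset.coe_range, mem_prod, Finset.mem_coe, mem_Iio] at hik hjl
    rw [Function.onFun, Set.disjoint_left]
    intro v hv hv'
    have hd := hdepth i k hik.1 hik.2 v hv
    have hd' := hdepth j l hjl.1 hjl.2 v hv'
    have hkl : k = l := by
      have e1 : (k : ℝ) < l + 1 := lt_of_mul_lt_mul_left (hd.1.trans hd'.2) (by positivity)
      have e2 : (l : ℝ) < k + 1 := lt_of_mul_lt_mul_left (hd'.1.trans hd.2) (by positivity)
      norm_cast at e1 e2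
      omega
    subst hkl
    have hij : i ≠ j := fun e => hne (by rw [e])
    obtain ⟨u, hu, rfl⟩ := hv
    obtain ⟨u', hu', he⟩ := hv'
    have : u' = u := smul_right_injective _ (by linarith [hqhalf k hik.2] : q k ≠ 0) he
    subst this
    exact Set.disjoint_left.1 (disjoint_koranyiEllipsoid hδ hη hη1 hηδ (hz i) (hz j)
      (hS i hik.1).2.1 (hS j hjl.1).2.1 (hS i hik.1).1 (hS j hjl.1).1 (hsep i j hij)) hu hu'
  have hsub : (⋃ p ∈ S ×ˢ Finset.range K, F p) ⊆ koranyiEllipsoid w (√R / 2) 25 := by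
    refine iUnion₂_subset ?_
    rintro ⟨j, k⟩ hp v hv
    simp only [Finset.mem_product, Finset.mem_range] at hp
    have hd := hdepth j k hp.1 hp.2 v hv
    have hv1 : ‖v‖ < 1 := by
      have : 0 ≤ 2 * h * k := by positivity
      nlinarith [norm_nonneg v]
    refine mem_koranyiEllipsoid_of_norm_le hR hR4 hw hv1 hwR ?_
    obtain ⟨u, hu, rfl⟩ := hv
    obtain ⟨e1, -, e2⟩ := hEb j hp.1 u hu
    change ‖1 - ⟪w, q k • u⟫_ℂ‖ ≤ 3 * R
    have e3 : 1 - ⟪w, q k • u⟫_ℂ = (q k : ℂ) * (1 - ⟪w, u⟫_ℂ) + ((1 - q k : ℝ) : ℂ) := by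
      rw [← Complex.coe_smul, inner_smul_right]
      push_cast
      ring
    rw [e3]
    refine (norm_add_le _ _).trans ?_
    rw [norm_mul, Complex.norm_real, Complex.norm_real, Real.norm_eq_abs, Real.norm_eq_abs,
      abs_of_nonneg (hq0 k), abs_of_nonneg (sub_nonneg.2 (hq1 k))]
    have e4 : q k * ‖1 - ⟪w, u⟫_ℂ‖ ≤ 1 * (2 * R) :=
      mul_le_mul (hq1 k) e2 (norm_nonneg _) zero_le_one
    have e5 : 1 - q k ≤ 1 - q k ^ 2 := by nlinarith [hq0 k, hq1 k]
    rw [hq2 k hp.2] at e5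
    linarith [hk k hp.2]
  have hlow (p : ℕ × ℕ) (hp : p ∈ S ×ˢ Finset.range K) :
      (1 / 2) ^ D * ((h / 2) ^ (n + 1) * b) ≤ μ.real (F p) := by
    simp only [Finset.mem_product, Finset.mem_range] at hp
    have e1 : μ.real (F p) = q p.2 ^ D * μ.real (E p.1) := by
      rw [Measure.real, Measure.addHaar_smul, ENNReal.toReal_mul,
        abs_of_nonneg (pow_nonneg (hq0 _) _), ENNReal.toReal_ofReal (pow_nonneg (hq0 _) _),
        Measure.real]
    rw [e1, measureReal_koranyiEllipsoid]
    have hr := (hS p.1 hp.1).1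
    set r := 1 - ‖z p.1‖ ^ 2 with hrdef
    have hr0 : 0 ≤ r := by linarith
    have hs2 : √r ^ 2 = r := Real.sq_sqrt hr0
    have hs0 := Real.sqrt_nonneg r
    have hs1 : √r ≤ 1 := Real.sqrt_le_one.2 (by rw [hrdef]; linarith [sq_nonneg ‖z p.1‖])
    have e2 : √r ≤ 1 + (√r - 1) * ‖z p.1‖ ^ 2 := by
      nlinarith [mul_nonneg (sub_nonneg.2 hs1) hr0]
    have e3 : r ^ (n + 1) = (√r ^ n * √r) ^ 2 := by
      rw [← pow_succ, ← pow_mul, mul_comm, pow_mul, hs2]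
    have e4 : (h / 2) ^ (n + 1) ≤ r ^ (n + 1) := by gcongr; linarith
    have e5 : (√r ^ n * √r) ^ 2 ≤ (√r ^ n * (1 + (√r - 1) * ‖z p.1‖ ^ 2)) ^ 2 := by gcongr
    gcongr
    · exact hqhalf _ hp.2
    · linarith
  have hup : μ.real (koranyiEllipsoid w (√R / 2) 25) ≤ 81 * R ^ (n + 1) * M := by
    rw [measureReal_koranyiEllipsoid]
    set s := √R / 2 with hs
    have hsR : R = 4 * s ^ 2 := by rw [hs, div_pow, Real.sq_sqrt hR.le]; ring
    have hs0 : 0 < s := by positivity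
    have hs1 : s ≤ 1 := by nlinarith
    have e1 : 1 + (s - 1) * ‖w‖ ^ 2 ≤ 9 * s := by nlinarith [norm_nonneg w]
    have e2 : 0 ≤ 1 + (s - 1) * ‖w‖ ^ 2 := by nlinarith [norm_nonneg w]
    have e3 : (s ^ n * (9 * s)) ^ 2 = 81 * (s ^ 2) ^ (n + 1) := by ring_nf
    have e4 : (s ^ 2) ^ (n + 1) ≤ R ^ (n + 1) := by gcongr; nlinarith
    gcongr
    calc (s ^ n * (1 + (s - 1) * ‖w‖ ^ 2)) ^ 2 ≤ (s ^ n * (9 * s)) ^ 2 := by gcongr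
      _ ≤ _ := by rw [e3]; linarith
  have hcount : (S.card : ℝ) * (R / (16 * h)) * ((1 / 2) ^ D * ((h / 2) ^ (n + 1) * b)) ≤
      81 * R ^ (n + 1) * M := by
    calc (S.card : ℝ) * (R / (16 * h)) * ((1 / 2) ^ D * ((h / 2) ^ (n + 1) * b))
        ≤ S.card * K * ((1 / 2) ^ D * ((h / 2) ^ (n + 1) * b)) := by gcongr
      _ = ∑ p ∈ S ×ˢ Finset.range K, (1 / 2) ^ D * ((h / 2) ^ (n + 1) * b) := by
          simp
      _ ≤ ∑ p ∈ S ×ˢ Finset.range K, μ.real (F p) := Finset.sum_le_sum hlow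
      _ = μ.real (⋃ p ∈ S ×ˢ Finset.range K, F p) :=
          (measureReal_biUnion_finset hdisj (fun p _ => (hFc p).measurableSet)
            (fun p _ => (hFc p).measure_lt_top.ne)).symm
      _ ≤ μ.real (koranyiEllipsoid w (√R / 2) 25) :=
          measureReal_mono hsub (isCompact_koranyiEllipsoid _ _ _).measure_lt_top.ne
      _ ≤ _ := hup
  have hc : 0 < R / (16 * h) * ((1 / 2) ^ D * ((h / 2) ^ (n + 1) * b)) := by positivity
  rw [mul_assoc, ← le_div_iff₀ hc] at hcount
  refine hcount.trans (le_of_eq ?_)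
  simp only [div_pow, one_pow]
  field_simp
  ring

theorem tsum_ofReal_le_of_sum_fiber_le {ι κ : Type*} [DecidableEq κ] {f : ι → ℝ} (hf : ∀ j, 0 ≤ f j)
    (g : ι → κ) {B : κ → ℝ} {b : ℝ} (hB : HasSum B b) (hB0 : ∀ p, 0 ≤ B p)
    (h : ∀ (S : Finset ι) (p : κ), (∀ j ∈ S, g j = p) → ∑ j ∈ S, f j ≤ B p) :
    ∑' j, ENNReal.ofReal (f j) ≤ ENNReal.ofReal b := by
  rw [ENNReal.tsum_eq_iSup_sum]
  refine iSup_le fun S => ?_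
  rw [← ENNReal.ofReal_sum_of_nonneg fun j _ => hf j]
  refine ENNReal.ofReal_le_ofReal ?_
  rw [← Finset.sum_fiberwise_of_maps_to (t := S.image g) (fun j hj => Finset.mem_image_of_mem g hj)]
  calc ∑ p ∈ S.image g, ∑ j ∈ S with g j = p, f j ≤ ∑ p ∈ S.image g, B p :=
        Finset.sum_le_sum fun p _ => h _ p (by simp)
    _ ≤ b := sum_le_hasSum _ (fun p _ => hB0 p) hB

theorem dyadic_bound_eq {n m k : ℕ} {N d t ε : ℝ} (hd : 0 < d) :
    N * ((2 ^ m * d) / (2 * (2 ^ m * d) / 2 ^ k)) ^ n *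
        ((2 * (2 ^ m * d) / 2 ^ k) ^ t / ((2 ^ m * d) / 2) ^ (t + ε)) =
      N * ((2 : ℝ) ^ t * 2 ^ t * 2 ^ ε / 2 ^ n) * d ^ (-ε) *
        (((2 : ℝ) ^ ε)⁻¹ ^ m * ((2 : ℝ) ^ (t - n))⁻¹ ^ k) := by
  set R := 2 ^ m * d with hR
  have hR0 : 0 < R := by positivity
  have hRε : R ^ ε = ((2 : ℝ) ^ ε) ^ m * d ^ ε := by
    rw [hR, Real.mul_rpow (by positivity) hd.le, Real.rpow_pow_comm (by norm_num)]
  have hX : ((2 : ℝ) ^ k) ^ t = ((2 : ℝ) ^ (t - n)) ^ k * (2 ^ k) ^ n := by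
    rw [Real.rpow_pow_comm (by norm_num), ← Real.rpow_natCast _ n,
      ← Real.rpow_add (by positivity), sub_add_cancel]
  have hquot : R / (2 * R / 2 ^ k) = 2 ^ k / 2 := by field_simp
  rw [hquot, Real.div_rpow (by positivity) (by positivity), Real.mul_rpow (by norm_num) hR0.le,
    Real.div_rpow hR0.le (by norm_num), Real.rpow_add hR0, Real.rpow_add (by norm_num : (0 : ℝ) < 2),
    hX, hRε, Real.rpow_neg hd.le, div_pow, inv_pow, inv_pow]
  have : 0 < R ^ t := by positivity
  have : 0 < d ^ ε := by positivity
  field_simp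

/-- Let `(z_j)` be a `δ`-separated sequence in `B_n`. For every `t > n`
and `ε > 0` there is `C > 0`, depending only on `n,t,ε,δ`, such that
`∑_j (1-|z_j|²)^t / |1-⟨z,z_j⟩|^{t+ε} ≤ C (1-|z|²)^{-ε}` for all `z ∈ B_n`. -/
theorem stmt18 (n : ℕ) (hn : 1 ≤ n) (δ : ℝ) (hδ : 0 < δ) (t ε : ℝ)
    (ht : (n : ℝ) < t) (hε : 0 < ε) :
    ∃ C : ℝ, 0 < C ∧
      ∀ z : ℕ → En n, (∀ j, z j ∈ Bn n) →
        (∀ i j, i ≠ j → δ ≤ ‖mob (z i) (z j)‖) →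
        ∀ w ∈ Bn n,
          ∑' j, ENNReal.ofReal
              ((1 - ‖z j‖ ^ 2) ^ t / ‖(1 : ℂ) - herm w (z j)‖ ^ (t + ε)) ≤
            ENNReal.ofReal (C * (1 - ‖w‖ ^ 2) ^ (-ε)) := by
  obtain ⟨N, hN, hcard⟩ := exists_card_le n hδ
  have hgeom (s : ℝ) (hs : 0 < s) :
      HasSum (fun i : ℕ => ((2 : ℝ) ^ s)⁻¹ ^ i) (1 - ((2 : ℝ) ^ s)⁻¹)⁻¹ ∧
        0 < (1 - ((2 : ℝ) ^ s)⁻¹)⁻¹ := by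
    have h1 : ((2 : ℝ) ^ s)⁻¹ < 1 := inv_lt_one_of_one_lt₀ (Real.one_lt_rpow (by norm_num) hs)
    exact ⟨hasSum_geometric_of_lt_one (by positivity) h1, inv_pos.2 (sub_pos.2 h1)⟩
  obtain ⟨hs1, hp1⟩ := hgeom ε hε
  obtain ⟨hs2, hp2⟩ := hgeom (t - n) (sub_pos.2 ht)
  set A : ℝ := N * ((2 : ℝ) ^ t * 2 ^ t * 2 ^ ε / 2 ^ n) with hA
  refine ⟨A * ((1 - ((2 : ℝ) ^ ε)⁻¹)⁻¹ * (1 - ((2 : ℝ) ^ (t - n))⁻¹)⁻¹), by positivity, ?_⟩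
  intro z hz hsep w hw
  have hz1 (j : ℕ) : ‖z j‖ < 1 := mem_ball_zero_iff.1 (hz j)
  have hw1 : ‖w‖ < 1 := mem_ball_zero_iff.1 hw
  have hr (j : ℕ) : 0 < 1 - ‖z j‖ ^ 2 := by nlinarith [hz1 j, norm_nonneg (z j)]
  set d := 1 - ‖w‖ ^ 2 with hd
  have hd0 : 0 < d := by nlinarith [norm_nonneg w]
  simp only [herm_eq_inner]
  have hin (j : ℕ) : ‖⟪z j, w⟫_ℂ‖ ≤ ‖z j‖ * ‖w‖ := norm_inner_le_norm _ _
  have hge (j : ℕ) : 1 - ‖z j‖ * ‖w‖ ≤ ‖1 - ⟪z j, w⟫_ℂ‖ := by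
    have := norm_sub_norm_le (1 : ℂ) ⟪z j, w⟫_ℂ
    rw [norm_one] at this
    linarith [hin j]
  have hlt2 (j : ℕ) : ‖1 - ⟪z j, w⟫_ℂ‖ < 2 := by
    have := norm_sub_le (1 : ℂ) ⟪z j, w⟫_ℂ
    rw [norm_one] at this
    nlinarith [hin j, hz1 j, norm_nonneg w, norm_nonneg (z j)]
  have hm (j : ℕ) : ∃ m : ℕ, 2 ^ m * d / 2 ≤ ‖1 - ⟪z j, w⟫_ℂ‖ ∧ ‖1 - ⟪z j, w⟫_ℂ‖ < 2 ^ m * d := by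
    have h1 : 1 ≤ ‖1 - ⟪z j, w⟫_ℂ‖ / (d / 2) := by
      rw [one_le_div (by positivity)]
      nlinarith [hge j, hz1 j, norm_nonneg w, norm_nonneg (z j)]
    obtain ⟨m, h2, h3⟩ := exists_nat_pow_near h1 (one_lt_two)
    rw [le_div_iff₀ (by positivity)] at h2
    rw [div_lt_iff₀ (by positivity), pow_succ] at h3
    exact ⟨m, by linarith, by linarith⟩
  choose m hm1 hm2 using hm
  have hk (j : ℕ) : ∃ k : ℕ, 1 - ‖z j‖ ^ 2 ≤ 2 * (2 ^ m j * d) / 2 ^ k ∧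
      2 * (2 ^ m j * d) / 2 ^ k ≤ 2 * (1 - ‖z j‖ ^ 2) := by
    have h1 : 1 ≤ 2 * (2 ^ m j * d) / (1 - ‖z j‖ ^ 2) := by
      rw [one_le_div (hr j)]
      nlinarith [hge j, hm2 j, hz1 j, norm_nonneg w, norm_nonneg (z j)]
    obtain ⟨k, h2, h3⟩ := exists_nat_pow_near h1 (one_lt_two)
    rw [le_div_iff₀ (hr j)] at h2
    rw [div_lt_iff₀ (hr j), pow_succ] at h3
    refine ⟨k, ?_, ?_⟩
    · rw [le_div_iff₀ (by positivity)]; linarith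
    · rw [div_le_iff₀ (by positivity)]; linarith
  choose k hk1 hk2 using hk
  have hB := (hs1.mul hs2 (hs1.summable.mul_of_nonneg hs2.summable
    (fun i => by positivity) (fun i => by positivity))).mul_left (A * d ^ (-ε))
  rw [show A * ((1 - ((2 : ℝ) ^ ε)⁻¹)⁻¹ * (1 - ((2 : ℝ) ^ (t - n))⁻¹)⁻¹) * d ^ (-ε) =
    A * d ^ (-ε) * ((1 - ((2 : ℝ) ^ ε)⁻¹)⁻¹ * (1 - ((2 : ℝ) ^ (t - n))⁻¹)⁻¹) by ring]
  refine tsum_ofReal_le_of_sum_fiber_le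
    (fun j => div_nonneg (Real.rpow_nonneg (hr j).le _) (Real.rpow_nonneg (norm_nonneg _) _))
    (fun j => (m j, k j)) hB (fun p => by positivity) ?_
  rintro S ⟨a, b⟩ hS
  rcases S.eq_empty_or_nonempty with rfl | ⟨i, hi⟩
  · rw [Finset.sum_empty]; positivity
  simp only [Prod.mk.injEq] at hS
  have hR4 : 2 ^ a * d ≤ 4 := by
    have := hm1 i
    rw [(hS i hi).1] at this
    linarith [hlt2 i]
  have ht0 : 0 < t := (Nat.cast_nonneg n).trans_lt ht
  have hone : (1 : ℝ) ≤ 2 ^ b := one_le_pow₀ (by norm_num)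
  have hRd : d ≤ 2 ^ a * d := le_mul_of_one_le_left hd0.le (one_le_pow₀ (by norm_num))
  have hSc := hcard z w (2 ^ a * d) (2 * (2 ^ a * d) / 2 ^ b) S hz1 hsep hw1 (by positivity)
    (div_le_self (by positivity) hone) hR4 (by linarith) (fun j hj => by
      have h1 := hk1 j
      have h2 := hk2 j
      have h3 := hm2 j
      rw [(hS j hj).1] at h1 h2 h3
      rw [(hS j hj).2] at h1 h2
      exact ⟨h2, h1, h3⟩)
  calc ∑ j ∈ S, (1 - ‖z j‖ ^ 2) ^ t / ‖1 - ⟪z j, w⟫_ℂ‖ ^ (t + ε)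
      ≤ S.card • ((2 * (2 ^ a * d) / 2 ^ b) ^ t / ((2 ^ a * d) / 2) ^ (t + ε)) := by
        refine Finset.sum_le_card_nsmul _ _ _ fun j hj => ?_
        have h1 := hk1 j
        have h3 := hm1 j
        rw [(hS j hj).1] at h1 h3
        rw [(hS j hj).2] at h1
        have := (hr j).le
        gcongr
    _ ≤ N * ((2 ^ a * d) / (2 * (2 ^ a * d) / 2 ^ b)) ^ n *
        ((2 * (2 ^ a * d) / 2 ^ b) ^ t / ((2 ^ a * d) / 2) ^ (t + ε)) := by
        rw [nsmul_eq_mul]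
        gcongr
    _ = _ := dyadic_bound_eq hd0

end
end
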